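/- arXiv:0807.4302 — 2 statements merged into one kernel-verified Lean document; each statement's English description precedes it below -/
import Mathlib

section
/- Let f = (x+y)² − (x−y)⁵ and g = x + y in ℚ[x,y]. For every b ∈ ℚ[s], b satisfies the Bernstein–Sato functional equation for the pair (f, g) if and only if (s + 1)(s + 17/10)(s + 19/10)(s + 21/10)(s + 23/10) divides b in ℚ[s]; that is, b_{f,x+y}(s) = (s + 1)(s + 17/10)(s + 19/10)(s + 21/10)(s + 23/10). -/
open MvPolynomial Polynomial

/-- The iterated formal partial derivative `∂^α = ∏ᵢ ∂_{xᵢ}^{αᵢ}` applied to a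
multivariate polynomial (the partial derivatives pairwise commute, so the order
of the fold is immaterial). -/
noncomputable def pdIter {σ : Type*} [Fintype σ] (α : σ → ℕ)
    (p : MvPolynomial σ ℚ) : MvPolynomial σ ℚ :=
  Finset.univ.toList.foldl (fun q i => (⇑(MvPolynomial.pderiv i))^[α i] q) p

/-- `b ∈ ℚ[s]` satisfies the Bernstein–Sato functional equation for the pair
`(f, g)`: there are finitely many multi-indices `α` and polynomials
`p_α ∈ (ℚ[x])[s]` with `b(m)·g·f^m = Σ_α p_α(m)·∂^α(g·f^(m+1))` for all `m ∈ ℕ`. -/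
def SatisfiesBS {σ : Type*} [Fintype σ] (f g : MvPolynomial σ ℚ)
    (b : Polynomial ℚ) : Prop :=
  ∃ (A : Finset (σ → ℕ)) (p : (σ → ℕ) → Polynomial (MvPolynomial σ ℚ)),
    ∀ m : ℕ,
      MvPolynomial.C (Polynomial.eval (m : ℚ) b) * g * f ^ m =
        ∑ α ∈ A, Polynomial.eval ((m : ℕ) : MvPolynomial σ ℚ) (p α) *
          pdIter α (g * f ^ (m + 1))

/-- A derivation applied to the coefficients of a polynomial in `s`. -/
theorem exists_eval_C_eq_derivation {σ : Type*}
    (d : Derivation ℚ (MvPolynomial σ ℚ) (MvPolynomial σ ℚ))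
    (H : Polynomial (MvPolynomial σ ℚ)) :
    ∃ H' : Polynomial (MvPolynomial σ ℚ), ∀ c : ℚ,
      H'.eval (MvPolynomial.C c) = d (H.eval (MvPolynomial.C c)) := by
  induction H using Polynomial.induction_on' with
  | add p q hp hq =>
    obtain ⟨p', hp⟩ := hp
    obtain ⟨q', hq⟩ := hq
    exact ⟨p' + q', fun c => by simp [hp, hq]⟩
  | monomial n a =>
    refine ⟨Polynomial.monomial n (d a), fun c => ?_⟩
    rw [Polynomial.eval_monomial, Polynomial.eval_monomial, ← MvPolynomial.C_pow, mul_comm,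
      mul_comm a, MvPolynomial.C_mul', MvPolynomial.C_mul', Derivation.map_smul]

/-- Coefficientwise evaluation of `b ∈ ℚ[s]`, regarded as an element of `(ℚ[x])[s]`. -/
theorem eval_C_map_C {σ : Type*} (b : Polynomial ℚ) (c : ℚ) :
    (b.map (MvPolynomial.C : ℚ →+* MvPolynomial σ ℚ)).eval (MvPolynomial.C c) =
      MvPolynomial.C (b.eval c) := by
  rw [Polynomial.eval_map, Polynomial.eval₂_at_apply]

/-- The family `F` has the form `H(s) f ^ (s - N)`, where the specialization of `H` at `s₀` lies
in `I N`. -/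
def SpecializesIn {σ : Type*} (f : MvPolynomial σ ℚ) (s₀ : ℚ)
    (I : ℕ → Ideal (MvPolynomial σ ℚ)) (F : ℕ → MvPolynomial σ ℚ) : Prop :=
  ∃ (N : ℕ) (H : Polynomial (MvPolynomial σ ℚ)),
    (∀ m : ℕ, f ^ N * F m = H.eval (MvPolynomial.C (m : ℚ)) * f ^ m) ∧
      H.eval (MvPolynomial.C s₀) ∈ I N

section SpecializesIn

variable {σ : Type*} {f : MvPolynomial σ ℚ} {s₀ : ℚ} {I : ℕ → Ideal (MvPolynomial σ ℚ)}

theorem pow_mul_mem_iff (hI : ∀ N h, f * h ∈ I (N + 1) ↔ h ∈ I N) (N k : ℕ)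
    (h : MvPolynomial σ ℚ) : f ^ k * h ∈ I (N + k) ↔ h ∈ I N := by
  induction k with
  | zero => simp
  | succ k ih => rw [pow_succ', mul_assoc, ← add_assoc, hI, ih]

theorem SpecializesIn.zero : SpecializesIn f s₀ I fun _ => 0 :=
  ⟨0, 0, by simp, by simp⟩

theorem SpecializesIn.add (hI : ∀ N h, f * h ∈ I (N + 1) ↔ h ∈ I N)
    {F G : ℕ → MvPolynomial σ ℚ} (hF : SpecializesIn f s₀ I F) (hG : SpecializesIn f s₀ I G) :
    SpecializesIn f s₀ I fun m => F m + G m := by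
  obtain ⟨N, H, hH, hHI⟩ := hF
  obtain ⟨M, K, hK, hKI⟩ := hG
  refine ⟨N + M, Polynomial.C (f ^ M) * H + Polynomial.C (f ^ N) * K, fun m => ?_, ?_⟩
  · simp only [Polynomial.eval_add, Polynomial.eval_mul, Polynomial.eval_C]
    linear_combination f ^ M * hH m + f ^ N * hK m
  · simp only [Polynomial.eval_add, Polynomial.eval_mul, Polynomial.eval_C]
    refine add_mem ((pow_mul_mem_iff hI N M _).2 hHI) ?_
    rw [add_comm]
    exact (pow_mul_mem_iff hI M N _).2 hKI

theorem SpecializesIn.eval_mul (p : Polynomial (MvPolynomial σ ℚ)) {F : ℕ → MvPolynomial σ ℚ}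
    (hF : SpecializesIn f s₀ I F) :
    SpecializesIn f s₀ I fun m => p.eval (m : MvPolynomial σ ℚ) * F m := by
  obtain ⟨N, H, hH, hHI⟩ := hF
  refine ⟨N, p * H, fun m => ?_, ?_⟩
  · rw [Polynomial.eval_mul, map_natCast]
    simp only [map_natCast] at hH
    linear_combination p.eval (m : MvPolynomial σ ℚ) * hH m
  · rw [Polynomial.eval_mul]
    exact Ideal.mul_mem_left _ _ hHI

theorem SpecializesIn.pderiv
    (hD : ∀ N i h, h ∈ I N →
      f * MvPolynomial.pderiv i h + MvPolynomial.C (s₀ - N) * MvPolynomial.pderiv i f * h ∈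
        I (N + 1))
    (i : σ) {F : ℕ → MvPolynomial σ ℚ} (hF : SpecializesIn f s₀ I F) :
    SpecializesIn f s₀ I fun m => MvPolynomial.pderiv i (F m) := by
  obtain ⟨N, H, hH, hHI⟩ := hF
  obtain ⟨H', hH'⟩ := exists_eval_C_eq_derivation (MvPolynomial.pderiv i) H
  refine ⟨N + 1, Polynomial.C f * H' + (Polynomial.X - Polynomial.C (MvPolynomial.C (N : ℚ))) *
    Polynomial.C (MvPolynomial.pderiv i f) * H, fun m => ?_, ?_⟩
  · have h := congrArg (MvPolynomial.pderiv i) (hH m)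
    have hpow (k : ℕ) : f * MvPolynomial.pderiv i (f ^ k) =
        (k : MvPolynomial σ ℚ) * f ^ k * MvPolynomial.pderiv i f := by
      cases k with
      | zero => simp
      | succ k =>
        rw [MvPolynomial.pderiv_pow, Nat.add_sub_cancel]
        ring
    rw [MvPolynomial.pderiv_mul, MvPolynomial.pderiv_mul, ← hH'] at h
    simp only [Polynomial.eval_add, Polynomial.eval_mul, Polynomial.eval_C, Polynomial.eval_sub,
      Polynomial.eval_X]
    have hm := hH m
    simp only [map_natCast] at *
    linear_combination f * h - F m * hpow N +
      H.eval (m : MvPolynomial σ ℚ) * hpow m - (N : MvPolynomial σ ℚ) *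
        MvPolynomial.pderiv i f * hm
  · simp only [Polynomial.eval_add, Polynomial.eval_mul, Polynomial.eval_C, Polynomial.eval_sub,
      Polynomial.eval_X, hH']
    rw [← map_sub]
    exact hD N i _ hHI

theorem SpecializesIn.pdIter [Fintype σ]
    (hD : ∀ N i h, h ∈ I N →
      f * MvPolynomial.pderiv i h + MvPolynomial.C (s₀ - N) * MvPolynomial.pderiv i f * h ∈
        I (N + 1))
    (α : σ → ℕ) {F : ℕ → MvPolynomial σ ℚ} (hF : SpecializesIn f s₀ I F) :
    SpecializesIn f s₀ I fun m => _root_.pdIter α (F m) := by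
  unfold _root_.pdIter
  induction (Finset.univ : Finset σ).toList generalizing F with
  | nil => exact hF
  | cons i l ih =>
    refine ih (F := fun m => (⇑(MvPolynomial.pderiv i))^[α i] (F m)) ?_
    induction α i with
    | zero => exact hF
    | succ n ihn =>
      simp only [Function.iterate_succ_apply']
      exact ihn.pderiv hD i

/-- A system of ideals `I N`, to be thought of as `{h | h f ^ (s₀ - N) ∈ M}` for a `D`-submodule
`M` of `ℚ[x, f⁻¹] f ^ s₀` containing `g f ^ (s₀ + 1)`, constrains every `b` satisfying the
functional equation. -/
theorem SatisfiesBS.C_eval_mul_mem [Fintype σ] {g : MvPolynomial σ ℚ} {b : Polynomial ℚ}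
    (hb : SatisfiesBS f g b) (hf : f ≠ 0)
    (hI : ∀ N h, f * h ∈ I (N + 1) ↔ h ∈ I N)
    (hD : ∀ N i h, h ∈ I N →
      f * MvPolynomial.pderiv i h + MvPolynomial.C (s₀ - N) * MvPolynomial.pderiv i f * h ∈
        I (N + 1))
    (hg : f * g ∈ I 0) : MvPolynomial.C (b.eval s₀) * g ∈ I 0 := by
  obtain ⟨A, p, hA⟩ := hb
  have hbase : SpecializesIn f s₀ I fun m => g * f ^ (m + 1) :=
    ⟨0, Polynomial.C (f * g), fun m => by rw [Polynomial.eval_C]; ring, by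
      rwa [Polynomial.eval_C]⟩
  have hsum (B : Finset (σ → ℕ)) : SpecializesIn f s₀ I fun m => ∑ α ∈ B,
      Polynomial.eval (m : MvPolynomial σ ℚ) (p α) * _root_.pdIter α (g * f ^ (m + 1)) := by
    classical
    induction B using Finset.induction_on with
    | empty => simpa using SpecializesIn.zero
    | insert α B hα ih =>
      simp only [Finset.sum_insert hα]
      exact ((hbase.pdIter hD α).eval_mul (p α)).add hI ih
  obtain ⟨N, H, hH, hHI⟩ := hsum A
  have hEq : H = b.map MvPolynomial.C * Polynomial.C (f ^ N * g) := by
    refine Polynomial.eq_of_infinite_eval_eq _ _ (Set.Infinite.mono ?_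
      (Set.infinite_range_of_injective (f := fun m : ℕ => (MvPolynomial.C (m : ℚ) :
        MvPolynomial σ ℚ)) ?_))
    · rintro _ ⟨m, rfl⟩
      simp only [Set.mem_ofPred_eq, Polynomial.eval_mul, eval_C_map_C, Polynomial.eval_C]
      refine mul_right_cancel₀ (pow_ne_zero m hf) ?_
      rw [← hH m]
      beta_reduce
      rw [← hA m]
      ring
    · exact (MvPolynomial.C_injective σ ℚ).comp Nat.cast_injective
  rw [hEq, Polynomial.eval_mul, eval_C_map_C, Polynomial.eval_C, mul_left_comm] at hHI
  simpa using (pow_mul_mem_iff hI 0 N _).1 (by simpa using hHI)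

end SpecializesIn

theorem pderiv_pderiv_comm {σ : Type*} (i j : σ) (p : MvPolynomial σ ℚ) :
    MvPolynomial.pderiv i (MvPolynomial.pderiv j p) =
      MvPolynomial.pderiv j (MvPolynomial.pderiv i p) := by
  classical
  have h : ⁅MvPolynomial.pderiv (R := ℚ) i, MvPolynomial.pderiv j⁆ =
      (0 : Derivation ℚ (MvPolynomial σ ℚ) (MvPolynomial σ ℚ)) := by
    refine MvPolynomial.derivation_ext fun k => ?_
    simp [Derivation.commutator_apply, MvPolynomial.pderiv_X, Pi.single_apply, apply_ite]
  have := congrArg (fun d => d p) h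
  simpa [Derivation.commutator_apply, sub_eq_zero] using this

theorem foldl_iterate_pderiv_comm {σ : Type*} (α : σ → ℕ) (i : σ) (l : List σ)
    (p : MvPolynomial σ ℚ) :
    l.foldl (fun q k => (⇑(MvPolynomial.pderiv k))^[α k] q) (MvPolynomial.pderiv i p) =
      MvPolynomial.pderiv i (l.foldl (fun q k => (⇑(MvPolynomial.pderiv k))^[α k] q) p) := by
  induction l generalizing p with
  | nil => rfl
  | cons k l ih =>
    rw [List.foldl_cons, List.foldl_cons, ← ih]
    congr 1
    exact (Function.Commute.iterate_left (f := MvPolynomial.pderiv (R := ℚ) k)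
      (g := MvPolynomial.pderiv i) (pderiv_pderiv_comm k i) (α k)) p

theorem foldl_iterate_pderiv_add_single {σ : Type*} [DecidableEq σ] (α : σ → ℕ) (i : σ)
    (l : List σ) (hl : l.Nodup) (p : MvPolynomial σ ℚ) :
    l.foldl (fun q k => (⇑(MvPolynomial.pderiv k))^[(α + Pi.single i 1 : σ → ℕ) k] q) p =
      if i ∈ l then
        MvPolynomial.pderiv i (l.foldl (fun q k => (⇑(MvPolynomial.pderiv k))^[α k] q) p)
      else l.foldl (fun q k => (⇑(MvPolynomial.pderiv k))^[α k] q) p := by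
  induction l generalizing p with
  | nil => simp
  | cons k l ih =>
    rw [List.nodup_cons] at hl
    rw [List.foldl_cons, List.foldl_cons, ih hl.2]
    rcases eq_or_ne i k with rfl | hik
    · simp [hl.1, Function.iterate_succ_apply', foldl_iterate_pderiv_comm]
    · simp [hik, hik.symm]

theorem pderiv_pdIter {σ : Type*} [Fintype σ] [DecidableEq σ] (α : σ → ℕ) (i : σ)
    (p : MvPolynomial σ ℚ) :
    MvPolynomial.pderiv i (pdIter α p) = pdIter (α + Pi.single i 1) p := by
  unfold pdIter
  rw [foldl_iterate_pderiv_add_single α i _ (Finset.nodup_toList _)]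
  simp

/-- The families `m ↦ p(m)` with `p ∈ (ℚ[x])[s]`. -/
noncomputable def polynomialFamilies (σ : Type*) : Subring (ℕ → MvPolynomial σ ℚ) :=
  (RingHom.pi fun m : ℕ => Polynomial.evalRingHom (m : MvPolynomial σ ℚ)).range

/-- The families represented by `D[s] · g f ^ (s + 1)`. -/
noncomputable def bsModule {σ : Type*} [Fintype σ] (f g : MvPolynomial σ ℚ) :
    Submodule (polynomialFamilies σ) (ℕ → MvPolynomial σ ℚ) :=
  Submodule.span _ (Set.range fun α m => pdIter α (g * f ^ (m + 1)))

section bsModule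

variable {σ : Type*} [Fintype σ] {f g : MvPolynomial σ ℚ} {F : ℕ → MvPolynomial σ ℚ}

theorem eval_mul_mem_bsModule (hF : F ∈ bsModule f g) (p : Polynomial (MvPolynomial σ ℚ)) :
    (fun m : ℕ => p.eval (m : MvPolynomial σ ℚ) * F m) ∈ bsModule f g :=
  (bsModule f g).smul_mem (⟨_, p, rfl⟩ : polynomialFamilies σ) hF

theorem mul_mem_bsModule (hF : F ∈ bsModule f g) (a : MvPolynomial σ ℚ) :
    (fun m => a * F m) ∈ bsModule f g := by
  simpa using eval_mul_mem_bsModule hF (Polynomial.C a)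

theorem C_eval_mul_mem_bsModule (hF : F ∈ bsModule f g) (q : Polynomial ℚ) :
    (fun m : ℕ => MvPolynomial.C (q.eval (m : ℚ)) * F m) ∈ bsModule f g := by
  convert eval_mul_mem_bsModule hF (q.map MvPolynomial.C) using 3
  rw [← eval_C_map_C, map_natCast]

theorem self_mem_bsModule : (fun m => g * f ^ (m + 1)) ∈ bsModule f g := by
  refine Submodule.subset_span ⟨0, funext fun m => ?_⟩
  simp [pdIter]

theorem pderiv_mem_bsModule (hF : F ∈ bsModule f g) (i : σ) :
    (fun m => MvPolynomial.pderiv i (F m)) ∈ bsModule f g := by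
  classical
  induction hF using Submodule.span_induction with
  | mem F hF =>
    obtain ⟨α, rfl⟩ := hF
    exact Submodule.subset_span ⟨α + Pi.single i 1, funext fun m => (pderiv_pdIter α i _).symm⟩
  | zero =>
    simp only [Pi.zero_apply, map_zero]
    exact (bsModule f g).zero_mem
  | add F G _ _ hF hG =>
    simp only [Pi.add_apply, map_add]
    exact add_mem hF hG
  | smul a F hF' hF =>
    obtain ⟨_, p, rfl⟩ := a
    obtain ⟨p', hp'⟩ := exists_eval_C_eq_derivation (MvPolynomial.pderiv i) p
    convert add_mem (eval_mul_mem_bsModule hF' p') (eval_mul_mem_bsModule hF p) using 1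
    funext m
    have h := hp' m
    rw [map_natCast] at h
    rw [Pi.add_apply, h, ← MvPolynomial.pderiv_mul]
    rfl

theorem satisfiesBS_of_mem_bsModule {b : Polynomial ℚ}
    (hb : (fun m : ℕ => MvPolynomial.C (b.eval (m : ℚ)) * (g * f ^ m)) ∈ bsModule f g) :
    SatisfiesBS f g b := by
  obtain ⟨c, hc⟩ := Finsupp.mem_span_range_iff_exists_finsupp.1 hb
  choose p hp using fun α => (c α).2
  refine ⟨c.support, p, fun m => ?_⟩
  rw [mul_assoc]
  refine (congrFun hc m).symm.trans ?_
  rw [Finsupp.sum, Finset.sum_apply]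
  refine Finset.sum_congr rfl fun α _ => ?_
  have h := congrFun (hp α) m
  exact congrArg (· * _) h.symm

end bsModule

/-- Values on powers of `u` of the functionals below. -/
def uMoment : ℕ → ℚ
  | 0 => 1
  | 1 => 0
  | i + 2 => (i + 1) / 2 * uMoment i

/-- Values on powers of `v` of the functionals below. -/
def vMoment (r : ℕ) : ℕ → ℚ
  | 0 => if r = 0 then 1 else 0
  | 1 => if r = 1 then 1 else 0
  | 2 => if r = 2 then 1 else 0
  | 3 => if r = 3 then 1 else 0
  | 4 => 0
  | j + 5 => -(j + 1) / 5 * vMoment r j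

/-- The residue at `s = -(17 + 2 r) / 10` of `∫ u ^ i v ^ j (u² - v⁵) ^ (s - N)`, suitably
normalized. -/
def residueMoment (r N i j : ℕ) : ℚ :=
  if 5 * i + 2 * j = 10 * (N + 1) + 2 * r then
    uMoment i * vMoment r j / ∏ k ∈ Finset.range (N + 1), ((7 + 2 * r) / 10 + k : ℚ)
  else 0

/-- The functional `h ↦ Res ∫ h (u² - v⁵) ^ (s - N)` at `s = -(17 + 2 r) / 10`. -/
noncomputable def residue (r N : ℕ) : MvPolynomial (Fin 2) ℚ →ₗ[ℚ] ℚ :=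
  (MvPolynomial.basisMonomials (Fin 2) ℚ).constr ℚ fun d => residueMoment r N (d 0) (d 1)

theorem X_pow_mul_X_pow_eq (i j : ℕ) :
    (MvPolynomial.X 0 ^ i * MvPolynomial.X 1 ^ j : MvPolynomial (Fin 2) ℚ) =
      MvPolynomial.basisMonomials (Fin 2) ℚ (Finsupp.single 0 i + Finsupp.single 1 j) := by
  rw [MvPolynomial.coe_basisMonomials, MvPolynomial.X_pow_eq_monomial,
    MvPolynomial.X_pow_eq_monomial, MvPolynomial.monomial_mul, one_mul]

theorem residue_X_pow_mul_X_pow (r N i j : ℕ) :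
    residue r N (MvPolynomial.X 0 ^ i * MvPolynomial.X 1 ^ j) = residueMoment r N i j := by
  rw [X_pow_mul_X_pow_eq, residue, Module.Basis.constr_basis]
  simp

theorem linearMap_eq_zero_of_X_pow_mul_X_pow {L : MvPolynomial (Fin 2) ℚ →ₗ[ℚ] ℚ}
    (h : ∀ i j : ℕ, L (MvPolynomial.X 0 ^ i * MvPolynomial.X 1 ^ j) = 0) : L = 0 := by
  refine (MvPolynomial.basisMonomials (Fin 2) ℚ).ext fun d => ?_
  have hd : d = Finsupp.single 0 (d 0) + Finsupp.single 1 (d 1) := by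
    ext k
    fin_cases k <;> simp
  rw [hd, ← X_pow_mul_X_pow_eq, h]
  rfl

/-- The polynomial `u² - v⁵`. -/
noncomputable def cuspUV : MvPolynomial (Fin 2) ℚ :=
  MvPolynomial.X 0 ^ 2 - MvPolynomial.X 1 ^ 5

theorem residueMoment_add (r N i j : ℕ) :
    residueMoment r (N + 1) (i + 2) j - residueMoment r (N + 1) i (j + 5) =
      residueMoment r N i j := by
  have h1 : 5 * (i + 2) + 2 * j = 10 * (N + 1 + 1) + 2 * r ↔
      5 * i + 2 * j = 10 * (N + 1) + 2 * r := by omega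
  have h2 : 5 * i + 2 * (j + 5) = 10 * (N + 1 + 1) + 2 * r ↔
      5 * i + 2 * j = 10 * (N + 1) + 2 * r := by omega
  simp only [residueMoment, h1, h2]
  split_ifs with h
  · have hq : (5 * i + 2 * j : ℚ) = 10 * (N + 1) + 2 * r := by exact_mod_cast h
    have h0 : ((7 + 2 * r) / 10 + (N + 1 : ℕ) : ℚ) ≠ 0 := by positivity
    have hP : ∏ k ∈ Finset.range (N + 1), ((7 + 2 * r) / 10 + k : ℚ) ≠ 0 :=
      Finset.prod_ne_zero_iff.2 fun k _ => by positivity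
    rw [Finset.prod_range_succ _ (N + 1), uMoment, vMoment]
    field_simp
    push_cast
    linear_combination 10 * (uMoment i * vMoment r j) * hq
  · simp

theorem residueMoment_u (r N i j : ℕ) :
    (i + 1) * residueMoment r N i j =
      2 * ((17 + 2 * r) / 10 + N) * residueMoment r (N + 1) (i + 2) j := by
  have h1 : 5 * (i + 2) + 2 * j = 10 * (N + 1 + 1) + 2 * r ↔
      5 * i + 2 * j = 10 * (N + 1) + 2 * r := by omega
  simp only [residueMoment, h1]
  split_ifs with h
  · have h0 : ((7 + 2 * r) / 10 + (N + 1 : ℕ) : ℚ) ≠ 0 := by positivity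
    have hP : ∏ k ∈ Finset.range (N + 1), ((7 + 2 * r) / 10 + k : ℚ) ≠ 0 :=
      Finset.prod_ne_zero_iff.2 fun k _ => by positivity
    rw [Finset.prod_range_succ _ (N + 1), uMoment]
    field_simp
    push_cast
    ring
  · simp

theorem residueMoment_v (r N i j : ℕ) :
    (j + 1) * residueMoment r N i j =
      -5 * ((17 + 2 * r) / 10 + N) * residueMoment r (N + 1) i (j + 5) := by
  have h1 : 5 * i + 2 * (j + 5) = 10 * (N + 1 + 1) + 2 * r ↔
      5 * i + 2 * j = 10 * (N + 1) + 2 * r := by omega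
  simp only [residueMoment, h1]
  split_ifs with h
  · have h0 : ((7 + 2 * r) / 10 + (N + 1 : ℕ) : ℚ) ≠ 0 := by positivity
    have hP : ∏ k ∈ Finset.range (N + 1), ((7 + 2 * r) / 10 + k : ℚ) ≠ 0 :=
      Finset.prod_ne_zero_iff.2 fun k _ => by positivity
    rw [Finset.prod_range_succ _ (N + 1), vMoment]
    field_simp
    push_cast
    ring
  · simp

theorem residue_cuspUV_mul (r N : ℕ) (h : MvPolynomial (Fin 2) ℚ) :
    residue r (N + 1) (cuspUV * h) = residue r N h := by
  have hL : residue r (N + 1) ∘ₗ LinearMap.mulLeft ℚ cuspUV - residue r N = 0 := by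
    refine linearMap_eq_zero_of_X_pow_mul_X_pow fun i j => ?_
    have hX : cuspUV * (MvPolynomial.X 0 ^ i * MvPolynomial.X 1 ^ j) =
        MvPolynomial.X 0 ^ (i + 2) * MvPolynomial.X 1 ^ j -
          MvPolynomial.X 0 ^ i * MvPolynomial.X 1 ^ (j + 5) := by
      rw [cuspUV]
      ring
    simp only [LinearMap.sub_apply, LinearMap.comp_apply, LinearMap.mulLeft_apply, hX, map_sub,
      residue_X_pow_mul_X_pow, residueMoment_add, sub_self]
  simpa [sub_eq_zero] using LinearMap.congr_fun hL h

theorem residue_pderiv (r N : ℕ) (i : Fin 2) (h : MvPolynomial (Fin 2) ℚ) :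
    residue r (N + 1) (cuspUV * MvPolynomial.pderiv i h +
      MvPolynomial.C (-(17 + 2 * r) / 10 - N : ℚ) * (MvPolynomial.pderiv i cuspUV * h)) = 0 := by
  have hL : residue r N ∘ₗ (MvPolynomial.pderiv i).toLinearMap +
      (-(17 + 2 * r) / 10 - N : ℚ) • (residue r (N + 1) ∘ₗ
        LinearMap.mulLeft ℚ (MvPolynomial.pderiv i cuspUV)) = 0 := by
    refine linearMap_eq_zero_of_X_pow_mul_X_pow fun a b => ?_
    simp only [LinearMap.add_apply, LinearMap.comp_apply, LinearMap.mulLeft_apply,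
      LinearMap.smul_apply, smul_eq_mul, Derivation.coeFn_coe]
    fin_cases i
    · have hX : MvPolynomial.pderiv 0 cuspUV * (MvPolynomial.X 0 ^ a * MvPolynomial.X 1 ^ b) =
          (2 : ℚ) • (MvPolynomial.X 0 ^ (a + 1) * MvPolynomial.X 1 ^ b) := by
        simp [cuspUV, MvPolynomial.pderiv_X, MvPolynomial.smul_eq_C_mul, map_ofNat]
        ring
      simp only [Fin.zero_eta, hX, map_smul, residue_X_pow_mul_X_pow, smul_eq_mul]
      cases a with
      | zero => simp [residue, residueMoment, uMoment, MvPolynomial.pderiv_X]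
      | succ a =>
        have hX' : MvPolynomial.pderiv 0
            (MvPolynomial.X 0 ^ (a + 1) * MvPolynomial.X 1 ^ b : MvPolynomial (Fin 2) ℚ) =
            (a + 1 : ℚ) • (MvPolynomial.X 0 ^ a * MvPolynomial.X 1 ^ b) := by
          simp [MvPolynomial.pderiv_X, MvPolynomial.smul_eq_C_mul]
          ring
        rw [hX', map_smul, residue_X_pow_mul_X_pow, smul_eq_mul, residueMoment_u]
        ring
    · have hX : MvPolynomial.pderiv 1 cuspUV * (MvPolynomial.X 0 ^ a * MvPolynomial.X 1 ^ b) =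
          (-5 : ℚ) • (MvPolynomial.X 0 ^ a * MvPolynomial.X 1 ^ (b + 4)) := by
        simp [cuspUV, MvPolynomial.pderiv_X, MvPolynomial.smul_eq_C_mul, map_ofNat]
        ring
      simp only [Fin.mk_one, hX, map_smul, residue_X_pow_mul_X_pow, smul_eq_mul]
      cases b with
      | zero => simp [residue, residueMoment, vMoment, MvPolynomial.pderiv_X]
      | succ b =>
        have hX' : MvPolynomial.pderiv 1
            (MvPolynomial.X 0 ^ a * MvPolynomial.X 1 ^ (b + 1) : MvPolynomial (Fin 2) ℚ) =
            (b + 1 : ℚ) • (MvPolynomial.X 0 ^ a * MvPolynomial.X 1 ^ b) := by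
          simp [MvPolynomial.pderiv_X, MvPolynomial.smul_eq_C_mul]
          ring
        rw [hX', map_smul, residue_X_pow_mul_X_pow, smul_eq_mul, residueMoment_v]
        ring
  rw [map_add, residue_cuspUV_mul, MvPolynomial.C_mul', map_smul]
  exact LinearMap.congr_fun hL h

/-- The polynomial `(x + y)² - (x - y)⁵`. -/
noncomputable def cuspXY : MvPolynomial (Fin 2) ℚ :=
  (MvPolynomial.X 0 + MvPolynomial.X 1) ^ 2 - (MvPolynomial.X 0 - MvPolynomial.X 1) ^ 5

theorem cuspXY_ne_zero : cuspXY ≠ 0 := by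
  intro h
  have := congrArg (MvPolynomial.eval ![1, 1]) h
  norm_num [cuspXY] at this

/-- The coordinate change `x + y ↦ u`, `x - y ↦ v`. -/
noncomputable def toUV : MvPolynomial (Fin 2) ℚ →ₐ[ℚ] MvPolynomial (Fin 2) ℚ :=
  MvPolynomial.aeval ![MvPolynomial.C (1 / 2) * (MvPolynomial.X 0 + MvPolynomial.X 1),
    MvPolynomial.C (1 / 2) * (MvPolynomial.X 0 - MvPolynomial.X 1)]

theorem C_half_add_C_half {σ : Type*} :
    (MvPolynomial.C (1 / 2) + MvPolynomial.C (1 / 2) : MvPolynomial σ ℚ) = 1 := by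
  rw [← map_add]
  norm_num

theorem toUV_add : toUV (MvPolynomial.X 0 + MvPolynomial.X 1) = MvPolynomial.X 0 := by
  simp only [toUV, map_add, MvPolynomial.aeval_X, Matrix.cons_val_zero, Matrix.cons_val_one]
  linear_combination MvPolynomial.X 0 * C_half_add_C_half (σ := Fin 2)

theorem toUV_sub : toUV (MvPolynomial.X 0 - MvPolynomial.X 1) = MvPolynomial.X 1 := by
  simp only [toUV, map_sub, MvPolynomial.aeval_X, Matrix.cons_val_zero, Matrix.cons_val_one]
  linear_combination MvPolynomial.X 1 * C_half_add_C_half (σ := Fin 2)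

theorem toUV_cuspXY : toUV cuspXY = cuspUV := by
  rw [cuspXY, map_sub, map_pow, map_pow, toUV_add, toUV_sub, cuspUV]

/-- The derivations `∂_x = ∂_u + ∂_v` and `∂_y = ∂_u - ∂_v` in the coordinates `u`, `v`. -/
noncomputable def derivUV (i : Fin 2) :
    Derivation ℚ (MvPolynomial (Fin 2) ℚ) (MvPolynomial (Fin 2) ℚ) :=
  MvPolynomial.pderiv 0 + (-1 : ℚ) ^ (i : ℕ) • MvPolynomial.pderiv 1

theorem toUV_pderiv (i : Fin 2) (h : MvPolynomial (Fin 2) ℚ) :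
    toUV (MvPolynomial.pderiv i h) = derivUV i (toUV h) := by
  induction h using MvPolynomial.induction_on with
  | C a => simp [derivUV, ← MvPolynomial.algebraMap_eq]
  | add p q hp hq => simp only [map_add, hp, hq]
  | mul_X p j hp =>
    rw [MvPolynomial.pderiv_mul, map_add, map_mul, map_mul, hp, map_mul, Derivation.leibniz]
    have hX : toUV (MvPolynomial.pderiv i (MvPolynomial.X j)) =
        derivUV i (toUV (MvPolynomial.X j)) := by
      have h2 := C_half_add_C_half (σ := Fin 2)
      fin_cases i <;> fin_cases j <;>
        simp [derivUV, toUV, MvPolynomial.pderiv_X] <;>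
        simpa [mul_add] using h2.symm
    rw [hX, smul_eq_mul, smul_eq_mul]
    ring

theorem residue_derivUV (r N : ℕ) (i : Fin 2) (h : MvPolynomial (Fin 2) ℚ) :
    residue r (N + 1) (cuspUV * derivUV i h +
      MvPolynomial.C (-(17 + 2 * r) / 10 - N : ℚ) * (derivUV i cuspUV * h)) = 0 := by
  have hX : cuspUV * derivUV i h +
      MvPolynomial.C (-(17 + 2 * r) / 10 - N : ℚ) * (derivUV i cuspUV * h) =
      (cuspUV * MvPolynomial.pderiv 0 h +
        MvPolynomial.C (-(17 + 2 * r) / 10 - N : ℚ) * (MvPolynomial.pderiv 0 cuspUV * h)) +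
      (-1 : ℚ) ^ (i : ℕ) • (cuspUV * MvPolynomial.pderiv 1 h +
        MvPolynomial.C (-(17 + 2 * r) / 10 - N : ℚ) * (MvPolynomial.pderiv 1 cuspUV * h)) := by
    simp only [derivUV, Derivation.add_apply, Derivation.smul_apply, MvPolynomial.smul_eq_C_mul]
    ring
  rw [hX, map_add, map_smul, residue_pderiv, residue_pderiv, smul_zero, add_zero]

/-- The polynomials `h` such that the residue at `s = -(17 + 2 r) / 10` of
`∫ φ h (u² - v⁵) ^ (s - N)` vanishes for all `φ`. -/
noncomputable def residueIdeal (r N : ℕ) : Ideal (MvPolynomial (Fin 2) ℚ) where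
  carrier := {h | ∀ φ, residue r N (φ * toUV h) = 0}
  zero_mem' φ := by simp
  add_mem' ha hb φ := by rw [map_add, mul_add, map_add, ha, hb, add_zero]
  smul_mem' c h hh φ := by
    rw [smul_eq_mul, map_mul toUV, ← mul_assoc]
    exact hh _

theorem mem_residueIdeal {r N : ℕ} {h : MvPolynomial (Fin 2) ℚ} :
    h ∈ residueIdeal r N ↔ ∀ φ, residue r N (φ * toUV h) = 0 :=
  Iff.rfl

theorem cuspXY_mul_mem_residueIdeal (r N : ℕ) (h : MvPolynomial (Fin 2) ℚ) :
    cuspXY * h ∈ residueIdeal r (N + 1) ↔ h ∈ residueIdeal r N := by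
  simp only [mem_residueIdeal, map_mul, toUV_cuspXY, mul_left_comm _ cuspUV, residue_cuspUV_mul]

theorem pderiv_mem_residueIdeal (r N : ℕ) (i : Fin 2) (h : MvPolynomial (Fin 2) ℚ)
    (hh : h ∈ residueIdeal r N) :
    cuspXY * MvPolynomial.pderiv i h +
      MvPolynomial.C (-(17 + 2 * r) / 10 - N : ℚ) * MvPolynomial.pderiv i cuspXY * h ∈
        residueIdeal r (N + 1) := by
  rw [mem_residueIdeal] at hh ⊢
  intro φ
  have h1 := residue_derivUV r N i (φ * toUV h)
  have h2 := hh (derivUV i φ)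
  rw [← residue_cuspUV_mul] at h2
  have hX : φ * toUV (cuspXY * MvPolynomial.pderiv i h +
      MvPolynomial.C (-(17 + 2 * r) / 10 - N : ℚ) * MvPolynomial.pderiv i cuspXY * h) =
      (cuspUV * derivUV i (φ * toUV h) +
        MvPolynomial.C (-(17 + 2 * r) / 10 - N : ℚ) * (derivUV i cuspUV * (φ * toUV h))) -
      cuspUV * (derivUV i φ * toUV h) := by
    rw [map_add toUV, map_mul toUV, map_mul toUV, map_mul toUV, toUV_pderiv, toUV_pderiv,
      toUV_cuspXY, Derivation.leibniz, smul_eq_mul, smul_eq_mul, ← MvPolynomial.algebraMap_eq,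
      AlgHom.commutes]
    ring
  rw [hX, map_sub, h1, h2, sub_zero]

theorem mul_mem_residueIdeal {r : ℕ} (hr : r ≤ 3) :
    cuspXY * (MvPolynomial.X 0 + MvPolynomial.X 1) ∈ residueIdeal r 0 := by
  rw [mem_residueIdeal, map_mul toUV, toUV_cuspXY, toUV_add]
  have hL : residue r 0 ∘ₗ LinearMap.mulRight ℚ (cuspUV * MvPolynomial.X 0) = 0 := ?_
  · exact fun φ => LinearMap.congr_fun hL φ
  refine linearMap_eq_zero_of_X_pow_mul_X_pow fun i j => ?_
  have hX : MvPolynomial.X 0 ^ i * MvPolynomial.X 1 ^ j * (cuspUV * MvPolynomial.X 0) =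
      MvPolynomial.X 0 ^ (i + 3) * MvPolynomial.X 1 ^ j -
        MvPolynomial.X 0 ^ (i + 1) * MvPolynomial.X 1 ^ (j + 5) := by
    rw [cuspUV]
    ring
  rw [LinearMap.comp_apply, LinearMap.mulRight_apply, hX, map_sub, residue_X_pow_mul_X_pow,
    residue_X_pow_mul_X_pow, residueMoment, residueMoment, if_neg (by omega), if_neg (by omega),
    sub_zero]

theorem eval_eq_zero_of_satisfiesBS {b : Polynomial ℚ}
    (hb : SatisfiesBS cuspXY (MvPolynomial.X 0 + MvPolynomial.X 1) b) {r : ℕ} (hr : r ≤ 3) :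
    b.eval (-(17 + 2 * r) / 10 : ℚ) = 0 := by
  have h := hb.C_eval_mul_mem cuspXY_ne_zero (cuspXY_mul_mem_residueIdeal r)
    (pderiv_mem_residueIdeal r) (mul_mem_residueIdeal hr)
  have hφ := h (MvPolynomial.X 0 * MvPolynomial.X 1 ^ r)
  have hX (c : ℚ) : MvPolynomial.X 0 * MvPolynomial.X 1 ^ r *
      toUV (MvPolynomial.C c * (MvPolynomial.X 0 + MvPolynomial.X 1)) =
        c • (MvPolynomial.X 0 ^ 2 * MvPolynomial.X 1 ^ r) := by
    rw [map_mul toUV, toUV_add, ← MvPolynomial.algebraMap_eq, AlgHom.commutes,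
      MvPolynomial.algebraMap_eq, MvPolynomial.smul_eq_C_mul]
    ring
  rw [hX, map_smul, residue_X_pow_mul_X_pow, smul_eq_mul] at hφ
  refine (mul_eq_zero.1 hφ).resolve_right ?_
  have h0 : (7 + 2 * r : ℚ) ≠ 0 := by positivity
  rw [residueMoment, if_pos (by ring)]
  interval_cases r <;> norm_num [uMoment, vMoment]

theorem eval_neg_one_eq_zero_of_satisfiesBS {b : Polynomial ℚ}
    (hb : SatisfiesBS cuspXY (MvPolynomial.X 0 + MvPolynomial.X 1) b) :
    b.eval (-1 : ℚ) = 0 := by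
  have h := hb.C_eval_mul_mem (s₀ := -1) (I := fun N => Ideal.span {cuspXY ^ (N + 1)})
    cuspXY_ne_zero ?_ ?_ ?_
  · rw [zero_add, pow_one, Ideal.mem_span_singleton] at h
    have := map_dvd (MvPolynomial.eval ![1, 0]) h
    simpa [cuspXY] using this
  · intro N h
    rw [Ideal.mem_span_singleton, Ideal.mem_span_singleton, pow_succ',
      mul_dvd_mul_iff_left cuspXY_ne_zero]
  · intro N i h hh
    rw [Ideal.mem_span_singleton] at hh ⊢
    obtain ⟨q, rfl⟩ := hh
    refine ⟨MvPolynomial.pderiv i q, ?_⟩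
    rw [MvPolynomial.pderiv_mul, MvPolynomial.pderiv_pow, Nat.add_sub_cancel, map_sub, map_neg,
      map_one, map_natCast]
    push_cast
    ring
  · rw [zero_add, pow_one]
    exact Ideal.mul_mem_right _ _ (Ideal.mem_span_singleton_self _)

theorem pderiv_zero_cuspXY : MvPolynomial.pderiv 0 cuspXY = 2 * (MvPolynomial.X 0 + MvPolynomial.X 1) -
    5 * (MvPolynomial.X 0 - MvPolynomial.X 1) ^ 4 := by
  simp [cuspXY, MvPolynomial.pderiv_X]
  ring

theorem pderiv_one_cuspXY : MvPolynomial.pderiv 1 cuspXY = 2 * (MvPolynomial.X 0 + MvPolynomial.X 1) +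
    5 * (MvPolynomial.X 0 - MvPolynomial.X 1) ^ 4 := by
  simp [cuspXY, MvPolynomial.pderiv_X]
  ring

theorem euler_step {q : Polynomial ℚ} {k : ℕ}
    (hq : (fun m : ℕ => MvPolynomial.C (q.eval (m : ℚ)) *
      ((MvPolynomial.X 0 - MvPolynomial.X 1) ^ (k + 1) * cuspXY ^ (m + 1))) ∈
        bsModule cuspXY (MvPolynomial.X 0 + MvPolynomial.X 1)) :
    (fun m : ℕ => MvPolynomial.C
        (((Polynomial.X + Polynomial.C ((17 + 2 * k : ℚ) / 10)) * q).eval (m : ℚ)) *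
      ((MvPolynomial.X 0 - MvPolynomial.X 1) ^ k * cuspXY ^ (m + 1))) ∈
        bsModule cuspXY (MvPolynomial.X 0 + MvPolynomial.X 1) := by
  have hu := mul_mem_bsModule (C_eval_mul_mem_bsModule
    (self_mem_bsModule (f := cuspXY) (g := MvPolynomial.X 0 + MvPolynomial.X 1)) q)
    ((MvPolynomial.X 0 - MvPolynomial.X 1) ^ k)
  convert add_mem (add_mem (mul_mem_bsModule (pderiv_mem_bsModule hu 0) (MvPolynomial.C (1 / 4)))
    (mul_mem_bsModule (pderiv_mem_bsModule hu 1) (MvPolynomial.C (1 / 4))))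
    (add_mem (mul_mem_bsModule (pderiv_mem_bsModule hq 0) (MvPolynomial.C (1 / 10)))
    (mul_mem_bsModule (pderiv_mem_bsModule hq 1) (MvPolynomial.C (-1 / 10)))) using 1
  funext m
  have h20 : (20 : MvPolynomial (Fin 2) ℚ) * MvPolynomial.C (1 / 20) = 1 := by
    rw [← map_ofNat MvPolynomial.C, ← map_mul, ← map_one MvPolynomial.C]
    norm_num
  have h4 : (MvPolynomial.C (1 / 4) : MvPolynomial (Fin 2) ℚ) =
      5 * MvPolynomial.C (1 / 20) := by
    rw [← map_ofNat MvPolynomial.C, ← map_mul]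
    norm_num
  have h10 : (MvPolynomial.C (1 / 10) : MvPolynomial (Fin 2) ℚ) =
      2 * MvPolynomial.C (1 / 20) := by
    rw [← map_ofNat MvPolynomial.C, ← map_mul]
    norm_num
  have h10' : (MvPolynomial.C (-1 / 10) : MvPolynomial (Fin 2) ℚ) =
      -2 * MvPolynomial.C (1 / 20) := by
    rw [← map_ofNat MvPolynomial.C, ← map_neg, ← map_mul]
    norm_num
  have hk : (MvPolynomial.C ((17 + 2 * k : ℚ) / 10) : MvPolynomial (Fin 2) ℚ) =
      (34 + 4 * (k : MvPolynomial (Fin 2) ℚ)) * MvPolynomial.C (1 / 20) := by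
    rw [← map_natCast MvPolynomial.C, ← map_ofNat MvPolynomial.C 34,
      ← map_ofNat MvPolynomial.C 4, ← map_mul, ← map_add, ← map_mul]
    congr 1
    ring
  simp only [Pi.add_apply, h4, h10, h10', Polynomial.eval_mul, Polynomial.eval_add,
    Polynomial.eval_X, Polynomial.eval_C, map_mul, map_add, hk, map_natCast,
    MvPolynomial.pderiv_mul, MvPolynomial.pderiv_pow, MvPolynomial.pderiv_C, map_sub,
    MvPolynomial.pderiv_X_self, MvPolynomial.pderiv_X_of_ne (zero_ne_one' (Fin 2)),
    MvPolynomial.pderiv_X_of_ne (zero_ne_one' (Fin 2)).symm, Nat.add_sub_cancel]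
  have hc : cuspXY = (MvPolynomial.X 0 + MvPolynomial.X 1) ^ 2 -
      (MvPolynomial.X 0 - MvPolynomial.X 1) ^ 5 := rfl
  rw [pderiv_zero_cuspXY, pderiv_one_cuspXY, pow_succ cuspXY m]
  push_cast
  generalize cuspXY ^ m = w, MvPolynomial.C (1 / 20) = t at *
  rw [hc]
  linear_combination -((m : MvPolynomial (Fin 2) ℚ) * MvPolynomial.C (q.eval (m : ℚ)) *
    (MvPolynomial.X 0 - MvPolynomial.X 1) ^ k * ((MvPolynomial.X 0 + MvPolynomial.X 1) ^ 2 -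
      (MvPolynomial.X 0 - MvPolynomial.X 1) ^ 5) * w) * h20

theorem pow_four_mul_mem_bsModule :
    (fun m : ℕ => (MvPolynomial.X 0 - MvPolynomial.X 1) ^ 4 * cuspXY ^ (m + 1)) ∈
      bsModule cuspXY (MvPolynomial.X 0 + MvPolynomial.X 1) := by
  have h := self_mem_bsModule (f := cuspXY) (g := MvPolynomial.X 0 + MvPolynomial.X 1)
  convert add_mem
    (mul_mem_bsModule (pderiv_mem_bsModule h 0) (MvPolynomial.C (1 / 10) *
      (5 * (MvPolynomial.X 0 - MvPolynomial.X 1) ^ 4 +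
        2 * (MvPolynomial.X 0 + MvPolynomial.X 1))))
    (mul_mem_bsModule (pderiv_mem_bsModule h 1) (MvPolynomial.C (1 / 10) *
      (5 * (MvPolynomial.X 0 - MvPolynomial.X 1) ^ 4 -
        2 * (MvPolynomial.X 0 + MvPolynomial.X 1)))) using 1
  funext m
  have h10 : (10 : MvPolynomial (Fin 2) ℚ) * MvPolynomial.C (1 / 10) = 1 := by
    rw [← map_ofNat MvPolynomial.C, ← map_mul, ← map_one MvPolynomial.C]
    norm_num
  simp only [Pi.add_apply, MvPolynomial.pderiv_mul, MvPolynomial.pderiv_pow, map_add,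
    MvPolynomial.pderiv_X_self, MvPolynomial.pderiv_X_of_ne (zero_ne_one' (Fin 2)),
    MvPolynomial.pderiv_X_of_ne (zero_ne_one' (Fin 2)).symm, Nat.add_sub_cancel,
    pderiv_zero_cuspXY, pderiv_one_cuspXY, pow_succ cuspXY m]
  linear_combination -((MvPolynomial.X 0 - MvPolynomial.X 1) ^ 4 * cuspXY ^ m * cuspXY) * h10

theorem C_eval_mul_X_add_X_mem_bsModule {q : Polynomial ℚ}
    (hq : (fun m : ℕ => MvPolynomial.C (q.eval (m : ℚ)) * cuspXY ^ (m + 1)) ∈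
      bsModule cuspXY (MvPolynomial.X 0 + MvPolynomial.X 1)) :
    (fun m : ℕ => MvPolynomial.C (((Polynomial.X + Polynomial.C 1) * q).eval (m : ℚ)) *
      ((MvPolynomial.X 0 + MvPolynomial.X 1) * cuspXY ^ m)) ∈
        bsModule cuspXY (MvPolynomial.X 0 + MvPolynomial.X 1) := by
  convert add_mem (mul_mem_bsModule (pderiv_mem_bsModule hq 0) (MvPolynomial.C (1 / 4)))
    (mul_mem_bsModule (pderiv_mem_bsModule hq 1) (MvPolynomial.C (1 / 4))) using 1
  funext m
  have h4 : (4 : MvPolynomial (Fin 2) ℚ) * MvPolynomial.C (1 / 4) = 1 := by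
    rw [← map_ofNat MvPolynomial.C, ← map_mul, ← map_one MvPolynomial.C]
    norm_num
  simp only [Pi.add_apply, MvPolynomial.pderiv_mul, MvPolynomial.pderiv_pow,
    MvPolynomial.pderiv_C, Nat.add_sub_cancel, pderiv_zero_cuspXY, pderiv_one_cuspXY,
    Polynomial.eval_mul, Polynomial.eval_add, Polynomial.eval_X, Polynomial.eval_one, map_mul,
    map_add, map_natCast, map_one]
  push_cast
  linear_combination -(((m : MvPolynomial (Fin 2) ℚ) + 1) * MvPolynomial.C (q.eval (m : ℚ)) *
    (MvPolynomial.X 0 + MvPolynomial.X 1) * cuspXY ^ m) * h4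

theorem bernsteinSato_stmt_13 :
    ∀ b : Polynomial ℚ,
      SatisfiesBS ((X 0 + X 1) ^ 2 - (X 0 - X 1) ^ 5 : MvPolynomial (Fin 2) ℚ)
          (X 0 + X 1) b ↔
        (Polynomial.X + Polynomial.C (1 : ℚ)) *
            (Polynomial.X + Polynomial.C (17 / 10 : ℚ)) *
            (Polynomial.X + Polynomial.C (19 / 10 : ℚ)) *
            (Polynomial.X + Polynomial.C (21 / 10 : ℚ)) *
            (Polynomial.X + Polynomial.C (23 / 10 : ℚ)) ∣ b := by
  intro b
  constructor
  · intro hb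
    have hdvd {a : ℚ} (h : b.eval (-a) = 0) : Polynomial.X + Polynomial.C a ∣ b := by
      rw [← sub_neg_eq_add, ← Polynomial.C_neg]
      exact Polynomial.dvd_iff_isRoot.2 h
    have hcop {a c : ℚ} (h : a - c ≠ 0) :
        IsCoprime (Polynomial.X + Polynomial.C a) (Polynomial.X + Polynomial.C c) := by
      refine ⟨Polynomial.C (a - c)⁻¹, -Polynomial.C (a - c)⁻¹, ?_⟩
      have hC : Polynomial.C (a - c)⁻¹ * (Polynomial.C a - Polynomial.C c) = 1 := by
        rw [← Polynomial.C_sub, ← Polynomial.C_mul, inv_mul_cancel₀ h, Polynomial.C_1]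
      linear_combination hC
    have hroot {r : ℕ} (hr : r ≤ 3) := eval_eq_zero_of_satisfiesBS hb hr
    refine IsCoprime.mul_dvd ?_ (IsCoprime.mul_dvd ?_ (IsCoprime.mul_dvd ?_ (IsCoprime.mul_dvd ?_
      (hdvd (eval_neg_one_eq_zero_of_satisfiesBS hb)) (hdvd ?_)) (hdvd ?_)) (hdvd ?_)) (hdvd ?_)
    · refine .mul_left (.mul_left (.mul_left ?_ ?_) ?_) ?_ <;> exact hcop (by norm_num)
    · refine .mul_left (.mul_left ?_ ?_) ?_ <;> exact hcop (by norm_num)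
    · refine .mul_left ?_ ?_ <;> exact hcop (by norm_num)
    · exact hcop (by norm_num)
    · convert hroot (r := 0) (by norm_num) using 2; norm_num
    · convert hroot (r := 1) (by norm_num) using 2; norm_num
    · convert hroot (r := 2) (by norm_num) using 2; norm_num
    · convert hroot (r := 3) (by norm_num) using 2; norm_num
  · rintro ⟨c, rfl⟩
    have h4 : (fun m : ℕ => MvPolynomial.C ((1 : Polynomial ℚ).eval (m : ℚ)) *
        ((MvPolynomial.X 0 - MvPolynomial.X 1) ^ (3 + 1) * cuspXY ^ (m + 1))) ∈
          bsModule cuspXY (MvPolynomial.X 0 + MvPolynomial.X 1) := by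
      simpa using pow_four_mul_mem_bsModule
    have h0 := euler_step (euler_step (euler_step (euler_step h4)))
    simp only [pow_zero, one_mul] at h0
    change SatisfiesBS cuspXY (MvPolynomial.X 0 + MvPolynomial.X 1) _
    refine satisfiesBS_of_mem_bsModule ?_
    convert C_eval_mul_mem_bsModule (C_eval_mul_X_add_X_mem_bsModule h0) c using 1
    funext m
    rw [← mul_assoc (MvPolynomial.C (c.eval _)), ← map_mul, ← Polynomial.eval_mul]
    congr 3
    norm_num
    ring
end

section
/- Let f = x·y·(x+y)·(x+2y) in ℚ[x,y] (a central arrangement of four lines). For every b ∈ ℚ[s], b satisfies the Bernstein–Sato functional equation for the pair (f, 1) if and only if (s + 1/2)(s + 3/4)(s + 1)²(s + 5/4)(s + 3/2) divides b in ℚ[s]; that is, b_f(s) = (s + 1/2)(s + 3/4)(s + 1)²(s + 5/4)(s + 3/2). -/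
open MvPolynomial Polynomial

theorem pdIter_eq (α : Fin 2 → ℕ) (p : MvPolynomial (Fin 2) ℚ) :
    pdIter α p = (⇑(MvPolynomial.pderiv (R := ℚ) (0 : Fin 2)))^[α 0]
      ((⇑(MvPolynomial.pderiv 1))^[α 1] p) := by
  have hperm : (Finset.univ : Finset (Fin 2)).toList.Perm [1, 0] := by
    rw [← Multiset.coe_eq_coe, Finset.coe_toList]
    decide
  have hcomm : ∀ q i j, (⇑(MvPolynomial.pderiv (R := ℚ) (j : Fin 2)))^[α j]
      ((⇑(MvPolynomial.pderiv i))^[α i] q) =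
      (⇑(MvPolynomial.pderiv i))^[α i] ((⇑(MvPolynomial.pderiv j))^[α j] q) := fun q i j =>
    (Function.Commute.iterate_iterate (fun p => pderiv_pderiv_comm j i p) _ _).eq q
  unfold pdIter
  rw [hperm.foldl_eq' fun i _ j _ q => hcomm q i j]
  rfl

theorem pdIter_add_single (α : Fin 2 → ℕ) (i : Fin 2) (p : MvPolynomial (Fin 2) ℚ) :
    pdIter (α + Pi.single i 1) p = MvPolynomial.pderiv i (pdIter α p) := by
  obtain rfl | rfl : i = 0 ∨ i = 1 := by omega
  · simp [pdIter_eq, Function.iterate_succ_apply']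
  · have h := (Function.Commute.iterate_right
      (fun p => pderiv_pderiv_comm (1 : Fin 2) 0 p) (α 0)).eq
        ((⇑(MvPolynomial.pderiv (R := ℚ) (1 : Fin 2)))^[α 1] p)
    simp [pdIter_eq, Function.iterate_succ_apply', h]

theorem exists_pderiv_eval {σ : Type*} (i : σ) (p : Polynomial (MvPolynomial σ ℚ)) :
    ∃ p' : Polynomial (MvPolynomial σ ℚ), ∀ m : ℕ,
      MvPolynomial.pderiv i (Polynomial.eval (m : MvPolynomial σ ℚ) p) =
        Polynomial.eval (m : MvPolynomial σ ℚ) p' := by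
  induction p using Polynomial.induction_on' with
  | add p q hp hq =>
    obtain ⟨p', hp⟩ := hp
    obtain ⟨q', hq⟩ := hq
    exact ⟨p' + q', fun m => by simp only [Polynomial.eval_add, map_add, hp, hq]⟩
  | monomial n r =>
    refine ⟨Polynomial.monomial n (MvPolynomial.pderiv i r), fun m => ?_⟩
    simp only [Polynomial.eval_monomial, ← Nat.cast_pow, MvPolynomial.pderiv_mul,
      Derivation.map_natCast, mul_zero, add_zero]

/-- The sequences `m ↦ P(m) • f ^ (m + 1)` for `P` a differential operator with coefficients
polynomial in the parameter `m`. -/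
inductive DSeq {σ : Type*} (f : MvPolynomial σ ℚ) : (ℕ → MvPolynomial σ ℚ) → Prop
  | base : DSeq f fun m => f ^ (m + 1)
  | add {U V : ℕ → MvPolynomial σ ℚ} : DSeq f U → DSeq f V → DSeq f fun m => U m + V m
  | const_mul (r : ℚ) {U : ℕ → MvPolynomial σ ℚ} :
      DSeq f U → DSeq f fun m => MvPolynomial.C r * U m
  | X_mul (i : σ) {U : ℕ → MvPolynomial σ ℚ} :
      DSeq f U → DSeq f fun m => MvPolynomial.X i * U m
  | index_mul {U : ℕ → MvPolynomial σ ℚ} : DSeq f U → DSeq f fun m => (m : MvPolynomial σ ℚ) * U m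
  | pderiv (i : σ) {U : ℕ → MvPolynomial σ ℚ} :
      DSeq f U → DSeq f fun m => MvPolynomial.pderiv i (U m)

namespace DSeq

variable {σ : Type*} {f : MvPolynomial σ ℚ} {U V : ℕ → MvPolynomial σ ℚ}

theorem congr (hU : DSeq f U) (h : ∀ m, V m = U m) : DSeq f V :=
  (funext h : V = U) ▸ hU

theorem zero : DSeq f fun _ => 0 :=
  (base.const_mul 0).congr fun m => by simp

theorem mvPoly_mul (hU : DSeq f U) (r : MvPolynomial σ ℚ) : DSeq f fun m => r * U m := by
  induction r using MvPolynomial.induction_on with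
  | C a => exact hU.const_mul a
  | add p q hp hq => exact (hp.add hq).congr fun m => by ring
  | mul_X p i hp => exact (hp.X_mul i).congr fun m => by ring

theorem pow_index_mul (hU : DSeq f U) (n : ℕ) :
    DSeq f fun m => (m : MvPolynomial σ ℚ) ^ n * U m := by
  induction n with
  | zero => exact hU.congr fun m => by ring
  | succ n ih => exact ih.index_mul.congr fun m => by ring

theorem poly_mul (hU : DSeq f U) (p : Polynomial (MvPolynomial σ ℚ)) :
    DSeq f fun m => Polynomial.eval (m : MvPolynomial σ ℚ) p * U m := by
  induction p using Polynomial.induction_on' with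
  | add p q hp hq => exact (hp.add hq).congr fun m => by rw [Polynomial.eval_add, add_mul]
  | monomial n r =>
    exact ((hU.pow_index_mul n).mvPoly_mul r).congr fun m => by
      rw [Polynomial.eval_monomial, mul_assoc]

theorem ratPoly_mul (hU : DSeq f U) (p : Polynomial ℚ) :
    DSeq f fun m => MvPolynomial.C (Polynomial.eval (m : ℚ) p) * U m :=
  (hU.poly_mul (p.map MvPolynomial.C)).congr fun m => by
    rw [← map_natCast (MvPolynomial.C : ℚ →+* MvPolynomial σ ℚ), Polynomial.eval_map_apply]

theorem finset_sum {ι : Type*} (s : Finset ι) {U : ι → ℕ → MvPolynomial σ ℚ}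
    (h : ∀ i ∈ s, DSeq f (U i)) : DSeq f fun m => ∑ i ∈ s, U i m := by
  classical
  induction s using Finset.induction_on with
  | empty => exact zero.congr fun m => by simp
  | insert i s hi ih =>
    refine ((h i (s.mem_insert_self i)).add
      (ih fun j hj => h j (Finset.mem_insert_of_mem hj))).congr fun m => ?_
    rw [Finset.sum_insert hi]

theorem iterate_pderiv (hU : DSeq f U) (i : σ) (n : ℕ) :
    DSeq f fun m => (⇑(MvPolynomial.pderiv i))^[n] (U m) := by
  induction n with
  | zero => exact hU
  | succ n ih =>
    exact (ih.pderiv i).congr fun m => Function.iterate_succ_apply' _ _ _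

theorem pdIter [Fintype σ] (hU : DSeq f U) (α : σ → ℕ) :
    DSeq f fun m => pdIter α (U m) := by
  unfold _root_.pdIter
  induction (Finset.univ : Finset σ).toList generalizing U with
  | nil => exact hU
  | cons i l ih => exact ih (hU.iterate_pderiv i (α i))

/-- Integration by parts: multiplication by a polynomial can be moved through a differential
operator up to derivatives. -/
theorem exists_poly_mul_eq {f : MvPolynomial (Fin 2) ℚ} {U : ℕ → MvPolynomial (Fin 2) ℚ}
    (hU : DSeq f U) (p : Polynomial (MvPolynomial (Fin 2) ℚ)) :
    ∃ (q : Polynomial (MvPolynomial (Fin 2) ℚ)) (V W : ℕ → MvPolynomial (Fin 2) ℚ),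
      DSeq f V ∧ DSeq f W ∧ ∀ m : ℕ,
        Polynomial.eval (m : MvPolynomial (Fin 2) ℚ) p * U m =
          Polynomial.eval (m : MvPolynomial (Fin 2) ℚ) q * f ^ (m + 1) +
            MvPolynomial.pderiv 0 (V m) + MvPolynomial.pderiv 1 (W m) := by
  induction hU generalizing p with
  | base => exact ⟨p, _, _, zero, zero, fun m => by simp⟩
  | add _ _ ihU ihV =>
    obtain ⟨q, V, W, hV, hW, h⟩ := ihU p
    obtain ⟨q', V', W', hV', hW', h'⟩ := ihV p
    refine ⟨q + q', _, _, hV.add hV', hW.add hW', fun m => ?_⟩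
    rw [mul_add, h, h', Polynomial.eval_add, map_add, map_add]
    ring
  | const_mul r _ hU =>
    obtain ⟨q, V, W, hV, hW, h⟩ := hU (p * Polynomial.C (MvPolynomial.C r))
    refine ⟨q, V, W, hV, hW, fun m => ?_⟩
    rw [← h, Polynomial.eval_mul, Polynomial.eval_C, mul_assoc]
  | X_mul i _ hU =>
    obtain ⟨q, V, W, hV, hW, h⟩ := hU (p * Polynomial.C (MvPolynomial.X i))
    refine ⟨q, V, W, hV, hW, fun m => ?_⟩
    rw [← h, Polynomial.eval_mul, Polynomial.eval_C, mul_assoc]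
  | index_mul _ hU =>
    obtain ⟨q, V, W, hV, hW, h⟩ := hU (p * Polynomial.X)
    refine ⟨q, V, W, hV, hW, fun m => ?_⟩
    rw [← h, Polynomial.eval_mul, Polynomial.eval_X, mul_assoc]
  | @pderiv i U hU ih =>
    obtain ⟨p', hp'⟩ := exists_pderiv_eval i p
    obtain ⟨q, V, W, hV, hW, h⟩ := ih (-p')
    have key : ∀ m : ℕ, Polynomial.eval (m : MvPolynomial (Fin 2) ℚ) p *
        MvPolynomial.pderiv i (U m) =
        MvPolynomial.pderiv i (Polynomial.eval (m : MvPolynomial (Fin 2) ℚ) p * U m) +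
          Polynomial.eval (m : MvPolynomial (Fin 2) ℚ) (-p') * U m := fun m => by
      rw [MvPolynomial.pderiv_mul, hp', Polynomial.eval_neg]
      ring
    obtain rfl | rfl : i = 0 ∨ i = 1 := by omega
    · refine ⟨q, _, W, (hU.poly_mul p).add hV, hW, fun m => ?_⟩
      rw [key, h, map_add]
      ring
    · refine ⟨q, V, _, hV, (hU.poly_mul p).add hW, fun m => ?_⟩
      rw [key, h, map_add]
      ring

end DSeq

/-- The two representations of differential operators applied to `f ^ (m + 1)` agree. -/
theorem DSeq.exists_finsupp {f : MvPolynomial (Fin 2) ℚ} {U : ℕ → MvPolynomial (Fin 2) ℚ}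
    (hU : DSeq f U) : ∃ c : (Fin 2 → ℕ) →₀ Polynomial (MvPolynomial (Fin 2) ℚ), ∀ m : ℕ,
      U m = c.sum fun α p => Polynomial.eval (m : MvPolynomial (Fin 2) ℚ) p *
        _root_.pdIter α (f ^ (m + 1)) := by
  have hmul : ∀ (p : Polynomial (MvPolynomial (Fin 2) ℚ))
      (c : (Fin 2 → ℕ) →₀ Polynomial (MvPolynomial (Fin 2) ℚ)) (m : ℕ),
      Polynomial.eval (m : MvPolynomial (Fin 2) ℚ) p * (c.sum fun α p =>
        Polynomial.eval (m : MvPolynomial (Fin 2) ℚ) p * _root_.pdIter α (f ^ (m + 1))) =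
      (p • c).sum fun α p =>
        Polynomial.eval (m : MvPolynomial (Fin 2) ℚ) p * _root_.pdIter α (f ^ (m + 1)) := by
    intro p c m
    rw [Finsupp.sum_smul_index (by simp), Finsupp.mul_sum]
    simp only [Polynomial.eval_mul, mul_assoc]
  induction hU with
  | base =>
    exact ⟨Finsupp.single 0 1, fun m => by simp [pdIter_eq]⟩
  | add _ _ hU hV =>
    obtain ⟨c, hc⟩ := hU
    obtain ⟨c', hc'⟩ := hV
    refine ⟨c + c', fun m => ?_⟩
    beta_reduce
    rw [hc, hc', Finsupp.sum_add_index'] <;> simp [add_mul]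
  | const_mul r _ hU =>
    obtain ⟨c, hc⟩ := hU
    exact ⟨Polynomial.C (MvPolynomial.C r) • c,
      fun m => by beta_reduce; rw [hc, ← hmul, Polynomial.eval_C]⟩
  | X_mul i _ hU =>
    obtain ⟨c, hc⟩ := hU
    exact ⟨Polynomial.C (MvPolynomial.X i) • c,
      fun m => by beta_reduce; rw [hc, ← hmul, Polynomial.eval_C]⟩
  | index_mul _ hU =>
    obtain ⟨c, hc⟩ := hU
    exact ⟨(Polynomial.X : Polynomial (MvPolynomial (Fin 2) ℚ)) • c,
      fun m => by beta_reduce; rw [hc, ← hmul, Polynomial.eval_X]⟩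
  | @pderiv i U _ hU =>
    obtain ⟨c, hc⟩ := hU
    suffices h : ∃ c' : (Fin 2 → ℕ) →₀ Polynomial (MvPolynomial (Fin 2) ℚ), ∀ m : ℕ,
        MvPolynomial.pderiv i (c.sum fun α p =>
          Polynomial.eval (m : MvPolynomial (Fin 2) ℚ) p * _root_.pdIter α (f ^ (m + 1))) =
        c'.sum fun α p =>
          Polynomial.eval (m : MvPolynomial (Fin 2) ℚ) p * _root_.pdIter α (f ^ (m + 1)) by
      obtain ⟨c', hc'⟩ := h
      exact ⟨c', fun m => by beta_reduce; rw [hc, hc']⟩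
    clear hc
    induction c using Finsupp.induction_linear with
    | zero => exact ⟨0, fun m => by simp⟩
    | add a b ha hb =>
      obtain ⟨c, hc⟩ := ha
      obtain ⟨c', hc'⟩ := hb
      refine ⟨c + c', fun m => ?_⟩
      rw [Finsupp.sum_add_index' (by simp) (by simp [add_mul]), map_add, hc, hc',
        Finsupp.sum_add_index' (by simp) (by simp [add_mul])]
    | single α p =>
      obtain ⟨p', hp'⟩ := exists_pderiv_eval i p
      refine ⟨Finsupp.single α p' + Finsupp.single (α + Pi.single i 1) p, fun m => ?_⟩
      rw [Finsupp.sum_single_index (by simp), Finsupp.sum_add_index' (by simp) (by simp [add_mul]),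
        Finsupp.sum_single_index (by simp), Finsupp.sum_single_index (by simp),
        MvPolynomial.pderiv_mul, hp', pdIter_add_single]

theorem satisfiesBS_one_iff (f : MvPolynomial (Fin 2) ℚ) (b : Polynomial ℚ) :
    SatisfiesBS f 1 b ↔ DSeq f fun m => MvPolynomial.C (Polynomial.eval (m : ℚ) b) * f ^ m := by
  constructor
  · rintro ⟨A, p, h⟩
    refine (DSeq.finset_sum A fun α _ => (DSeq.base.pdIter α).poly_mul (p α)).congr fun m => ?_
    simpa only [mul_one, one_mul] using h m
  · intro h
    obtain ⟨c, hc⟩ := h.exists_finsupp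
    refine ⟨c.support, c, fun m => ?_⟩
    simpa only [mul_one, one_mul, Finsupp.sum] using hc m

/-- The defining polynomial of the arrangement of the four lines `x = 0`, `y = 0`, `x + y = 0`
and `x + 2 * y = 0`. -/
noncomputable def fourLines : MvPolynomial (Fin 2) ℚ :=
  MvPolynomial.X 0 * MvPolynomial.X 1 * (MvPolynomial.X 0 + MvPolynomial.X 1) *
    (MvPolynomial.X 0 + 2 * MvPolynomial.X 1)

theorem pderiv_zero_fourLines : MvPolynomial.pderiv 0 fourLines =
    3 * MvPolynomial.X 0 ^ 2 * MvPolynomial.X 1 + 6 * MvPolynomial.X 0 * MvPolynomial.X 1 ^ 2 +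
      2 * MvPolynomial.X 1 ^ 3 := by
  have h2 : (2 : MvPolynomial (Fin 2) ℚ) = MvPolynomial.C 2 := (map_ofNat _ 2).symm
  simp only [fourLines, MvPolynomial.pderiv_mul, map_add, MvPolynomial.pderiv_X_self,
    MvPolynomial.pderiv_X_of_ne (zero_ne_one (α := Fin 2)).symm, h2, MvPolynomial.pderiv_C]
  rw [← h2]
  ring

theorem pderiv_one_fourLines : MvPolynomial.pderiv 1 fourLines =
    MvPolynomial.X 0 ^ 3 + 6 * MvPolynomial.X 0 ^ 2 * MvPolynomial.X 1 +
      6 * MvPolynomial.X 0 * MvPolynomial.X 1 ^ 2 := by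
  have h2 : (2 : MvPolynomial (Fin 2) ℚ) = MvPolynomial.C 2 := (map_ofNat _ 2).symm
  simp only [fourLines, MvPolynomial.pderiv_mul, map_add, MvPolynomial.pderiv_X_self,
    MvPolynomial.pderiv_X_of_ne (zero_ne_one (α := Fin 2)), h2, MvPolynomial.pderiv_C]
  rw [← h2]
  ring

theorem isHomogeneous_fourLines : fourLines.IsHomogeneous 4 := by
  have hX := fun i : Fin 2 => MvPolynomial.isHomogeneous_X ℚ i
  have h2 : (2 * MvPolynomial.X 1 : MvPolynomial (Fin 2) ℚ).IsHomogeneous 1 := by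
    rw [show (2 : MvPolynomial (Fin 2) ℚ) = MvPolynomial.C 2 from (map_ofNat _ 2).symm]
    simpa using (MvPolynomial.isHomogeneous_C (Fin 2) (2 : ℚ)).mul (hX 1)
  exact (((hX 0).mul (hX 1)).mul ((hX 0).add (hX 1))).mul ((hX 0).add h2)

/-- All forms of degree five lie in the Jacobian ideal. -/
theorem exists_eq_jacobian_combination {a b : ℕ} (h : a + b = 5) :
    ∃ A B : MvPolynomial (Fin 2) ℚ, MvPolynomial.X 0 ^ a * MvPolynomial.X 1 ^ b =
      A * MvPolynomial.pderiv 0 fourLines + B * MvPolynomial.pderiv 1 fourLines := by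
  suffices h' : ∃ u₁ u₂ u₃ v₁ v₂ v₃ : ℚ,
      (MvPolynomial.X 0 ^ a * MvPolynomial.X 1 ^ b : MvPolynomial (Fin 2) ℚ) =
      (MvPolynomial.C u₁ * MvPolynomial.X 0 ^ 2 +
        MvPolynomial.C u₂ * MvPolynomial.X 0 * MvPolynomial.X 1 +
        MvPolynomial.C u₃ * MvPolynomial.X 1 ^ 2) * MvPolynomial.pderiv 0 fourLines +
      (MvPolynomial.C v₁ * MvPolynomial.X 0 ^ 2 +
        MvPolynomial.C v₂ * MvPolynomial.X 0 * MvPolynomial.X 1 +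
        MvPolynomial.C v₃ * MvPolynomial.X 1 ^ 2) * MvPolynomial.pderiv 1 fourLines by
    obtain ⟨u₁, u₂, u₃, v₁, v₂, v₃, h'⟩ := h'
    exact ⟨_, _, h'⟩
  have key : ∀ u₁ u₂ u₃ v₁ v₂ v₃ : ℚ,
      (MvPolynomial.C u₁ * MvPolynomial.X 0 ^ 2 +
        MvPolynomial.C u₂ * MvPolynomial.X 0 * MvPolynomial.X 1 +
        MvPolynomial.C u₃ * MvPolynomial.X 1 ^ 2) * MvPolynomial.pderiv 0 fourLines +
      (MvPolynomial.C v₁ * MvPolynomial.X 0 ^ 2 +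
        MvPolynomial.C v₂ * MvPolynomial.X 0 * MvPolynomial.X 1 +
        MvPolynomial.C v₃ * MvPolynomial.X 1 ^ 2) * MvPolynomial.pderiv 1 fourLines =
      MvPolynomial.C v₁ * MvPolynomial.X 0 ^ 5 +
      MvPolynomial.C (3 * u₁ + 6 * v₁ + v₂) * (MvPolynomial.X 0 ^ 4 * MvPolynomial.X 1) +
      MvPolynomial.C (6 * u₁ + 3 * u₂ + 6 * v₁ + 6 * v₂ + v₃) *
        (MvPolynomial.X 0 ^ 3 * MvPolynomial.X 1 ^ 2) +
      MvPolynomial.C (2 * u₁ + 6 * u₂ + 3 * u₃ + 6 * v₂ + 6 * v₃) *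
        (MvPolynomial.X 0 ^ 2 * MvPolynomial.X 1 ^ 3) +
      MvPolynomial.C (2 * u₂ + 6 * u₃ + 6 * v₃) * (MvPolynomial.X 0 * MvPolynomial.X 1 ^ 4) +
      MvPolynomial.C (2 * u₃) * MvPolynomial.X 1 ^ 5 := by
    intro u₁ u₂ u₃ v₁ v₂ v₃
    rw [pderiv_zero_fourLines, pderiv_one_fourLines]
    simp only [map_add, map_mul, map_ofNat]
    ring
  have ha : a ≤ 5 := by omega
  obtain rfl : b = 5 - a := by omega
  simp only [key]
  interval_cases a
  · exact ⟨3/8, 15/8, 1/2, 0, -9/8, -9/8, by norm_num⟩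
  · exact ⟨-3/8, -7/4, 0, 0, 9/8, 3/4, by norm_num⟩
  · exact ⟨1/2, 9/4, 0, 0, -3/2, -3/4, by norm_num⟩
  · exact ⟨-3/4, -3, 0, 0, 9/4, 1, by norm_num⟩
  · exact ⟨3/2, 9/2, 0, 0, -7/2, -3/2, by norm_num⟩
  · exact ⟨-9/2, -9, 0, 1, 15/2, 3, by norm_num⟩

theorem dseq_top {a b : ℕ} (h : a + b = 5) : DSeq fourLines fun m =>
    MvPolynomial.C (Polynomial.eval (m : ℚ) (Polynomial.X + 1)) *
      (MvPolynomial.X 0 ^ a * MvPolynomial.X 1 ^ b * fourLines ^ m) := by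
  obtain ⟨A, B, hAB⟩ := exists_eq_jacobian_combination h
  refine (((DSeq.base.pderiv 0).mvPoly_mul A).add
    ((DSeq.base.pderiv 1).mvPoly_mul B)).congr fun m => ?_
  rw [hAB]
  simp only [MvPolynomial.pderiv_pow, Polynomial.eval_add, Polynomial.eval_X, Polynomial.eval_one,
    map_add, map_one, map_natCast, Nat.cast_add, Nat.cast_one, add_tsub_cancel_right]
  ring

/-- Euler's identity for `X 0 ^ a * X 1 ^ b * fourLines ^ m`. -/
theorem pderiv_X_mul_add_pderiv_X_mul (a b m : ℕ) :
    MvPolynomial.pderiv 0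
        (MvPolynomial.X 0 ^ (a + 1) * MvPolynomial.X 1 ^ b * fourLines ^ m) +
      MvPolynomial.pderiv 1
        (MvPolynomial.X 0 ^ a * MvPolynomial.X 1 ^ (b + 1) * fourLines ^ m) =
    MvPolynomial.C (4 * m + (a + b + 2) : ℚ) *
      (MvPolynomial.X 0 ^ a * MvPolynomial.X 1 ^ b * fourLines ^ m) := by
  have hX := fun i : Fin 2 => MvPolynomial.isHomogeneous_X ℚ i
  have hE := ((((hX 0).pow a).mul ((hX 1).pow b)).mul
    (isHomogeneous_fourLines.pow m)).sum_X_mul_pderiv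
  set h : MvPolynomial (Fin 2) ℚ :=
    MvPolynomial.X 0 ^ a * MvPolynomial.X 1 ^ b * fourLines ^ m with hh
  rw [show MvPolynomial.X 0 ^ (a + 1) * MvPolynomial.X 1 ^ b * fourLines ^ m =
      MvPolynomial.X 0 * h by rw [hh]; ring,
    show MvPolynomial.X 0 ^ a * MvPolynomial.X 1 ^ (b + 1) * fourLines ^ m =
      MvPolynomial.X 1 * h by rw [hh]; ring]
  simp only [MvPolynomial.pderiv_mul, MvPolynomial.pderiv_X_self]
  rw [Fin.sum_univ_two, nsmul_eq_mul] at hE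
  simp only [map_add, map_mul, map_ofNat, map_natCast]
  push_cast at hE
  linear_combination hE

theorem dseq_step {n : ℕ} {r : Polynomial ℚ}
    (hr : ∀ a b : ℕ, a + b = n + 1 → DSeq fourLines fun m =>
      MvPolynomial.C (Polynomial.eval (m : ℚ) r) *
        (MvPolynomial.X 0 ^ a * MvPolynomial.X 1 ^ b * fourLines ^ m))
    (a b : ℕ) (hab : a + b = n) : DSeq fourLines fun m =>
      MvPolynomial.C (Polynomial.eval (m : ℚ) (r * (4 * Polynomial.X + Polynomial.C (n + 2 : ℚ)))) *
        (MvPolynomial.X 0 ^ a * MvPolynomial.X 1 ^ b * fourLines ^ m) := by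
  refine (((hr (a + 1) b (by omega)).pderiv 0).add
    ((hr a (b + 1) (by omega)).pderiv 1)).congr fun m => ?_
  rw [MvPolynomial.pderiv_C_mul, MvPolynomial.pderiv_C_mul, ← mul_add,
    pderiv_X_mul_add_pderiv_X_mul, ← mul_assoc (MvPolynomial.C _) (MvPolynomial.C _),
    ← map_mul, ← hab]
  simp

theorem dseq_fourLines_of_dvd {b : Polynomial ℚ}
    (hb : (Polynomial.X + Polynomial.C (1 / 2 : ℚ)) * (Polynomial.X + Polynomial.C (3 / 4 : ℚ)) *
      (Polynomial.X + Polynomial.C (1 : ℚ)) ^ 2 * (Polynomial.X + Polynomial.C (5 / 4 : ℚ)) *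
      (Polynomial.X + Polynomial.C (3 / 2 : ℚ)) ∣ b) :
    DSeq fourLines fun m => MvPolynomial.C (Polynomial.eval (m : ℚ) b) * fourLines ^ m := by
  obtain ⟨q, rfl⟩ := hb
  have h := dseq_step (dseq_step (dseq_step (dseq_step (dseq_step fun a b hab => dseq_top hab))))
    0 0 rfl
  refine (h.ratPoly_mul (Polynomial.C (1 / 4 ^ 5) * q)).congr fun m => ?_
  rw [pow_zero, pow_zero, one_mul, one_mul, ← mul_assoc, ← map_mul]
  congr 2
  simp only [Polynomial.eval_mul, Polynomial.eval_add, Polynomial.eval_pow, Polynomial.eval_X,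
    Polynomial.eval_C, Polynomial.eval_one, Polynomial.eval_ofNat]
  push_cast
  ring

/-- The degree `j` component of a bivariate polynomial, restricted to the line `X 1 = 1`. -/
noncomputable def degreePart (j : ℤ) : MvPolynomial (Fin 2) ℚ →ₗ[ℚ] Polynomial ℚ :=
  (MvPolynomial.basisMonomials (Fin 2) ℚ).constr ℚ fun α =>
    if ((α 0 + α 1 : ℕ) : ℤ) = j then Polynomial.X ^ α 0 else 0

theorem degreePart_monomial (j : ℤ) (α : Fin 2 →₀ ℕ) (r : ℚ) :
    degreePart j (MvPolynomial.monomial α r) =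
      if ((α 0 + α 1 : ℕ) : ℤ) = j then Polynomial.C r * Polynomial.X ^ α 0 else 0 := by
  have h := (MvPolynomial.basisMonomials (Fin 2) ℚ).constr_basis ℚ (fun α =>
    if ((α 0 + α 1 : ℕ) : ℤ) = j then (Polynomial.X ^ α 0 : Polynomial ℚ) else 0) α
  rw [MvPolynomial.coe_basisMonomials] at h
  rw [← mul_one r, ← smul_eq_mul, ← MvPolynomial.smul_monomial, map_smul, degreePart, h,
    smul_ite, smul_zero, Polynomial.smul_eq_C_mul, smul_eq_mul, mul_one]

theorem degreePart_C_mul (j : ℤ) (r : ℚ) (h : MvPolynomial (Fin 2) ℚ) :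
    degreePart j (MvPolynomial.C r * h) = Polynomial.C r * degreePart j h := by
  rw [MvPolynomial.C_mul', map_smul, Polynomial.smul_eq_C_mul]

theorem degreePart_X_zero_mul (j : ℤ) (h : MvPolynomial (Fin 2) ℚ) :
    degreePart j (MvPolynomial.X 0 * h) = Polynomial.X * degreePart (j - 1) h := by
  induction h using MvPolynomial.induction_on' with
  | add p q hp hq => rw [mul_add, map_add, hp, hq, map_add, mul_add]
  | monomial α r =>
    rw [MvPolynomial.X, MvPolynomial.monomial_mul, degreePart_monomial, degreePart_monomial,
      mul_ite, mul_zero]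
    refine if_congr ?_ ?_ rfl
    · simp only [Finsupp.add_apply, Finsupp.single_apply]
      norm_num
      omega
    · simp only [Finsupp.add_apply, Finsupp.single_eq_same, one_mul]
      ring

theorem degreePart_X_one_mul (j : ℤ) (h : MvPolynomial (Fin 2) ℚ) :
    degreePart j (MvPolynomial.X 1 * h) = degreePart (j - 1) h := by
  induction h using MvPolynomial.induction_on' with
  | add p q hp hq => rw [mul_add, map_add, hp, hq, map_add]
  | monomial α r =>
    rw [MvPolynomial.X, MvPolynomial.monomial_mul, degreePart_monomial, degreePart_monomial]
    refine if_congr ?_ ?_ rfl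
    · simp only [Finsupp.add_apply, Finsupp.single_apply]
      norm_num
      omega
    · simp

theorem degreePart_pderiv_zero (j : ℤ) (h : MvPolynomial (Fin 2) ℚ) :
    degreePart j (MvPolynomial.pderiv 0 h) = Polynomial.derivative (degreePart (j + 1) h) := by
  induction h using MvPolynomial.induction_on' with
  | add p q hp hq => rw [map_add, map_add, hp, hq, map_add, map_add]
  | monomial α r =>
    rw [MvPolynomial.pderiv_monomial, degreePart_monomial, degreePart_monomial]
    rcases Nat.eq_zero_or_pos (α 0) with h0 | h0
    · simp [h0, apply_ite Polynomial.derivative]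
    · rw [apply_ite Polynomial.derivative, Polynomial.derivative_zero]
      refine if_congr ?_ ?_ rfl
      · simp only [Finsupp.tsub_apply, Finsupp.single_apply]
        norm_num
        omega
      · simp [mul_assoc, Polynomial.derivative_X_pow]

theorem degreePart_pderiv_one (j : ℤ) (h : MvPolynomial (Fin 2) ℚ) :
    degreePart j (MvPolynomial.pderiv 1 h) =
      Polynomial.C (j + 1 : ℚ) * degreePart (j + 1) h -
        Polynomial.X * Polynomial.derivative (degreePart (j + 1) h) := by
  induction h using MvPolynomial.induction_on' with
  | add p q hp hq =>
    simp only [map_add, hp, hq]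
    ring
  | monomial α r =>
    have key : degreePart j (MvPolynomial.pderiv 1 (MvPolynomial.monomial α r)) =
        if ((α 0 + α 1 : ℕ) : ℤ) = j + 1 then
          Polynomial.C (r * α 1) * Polynomial.X ^ α 0 else 0 := by
      rw [MvPolynomial.pderiv_monomial, degreePart_monomial]
      rcases Nat.eq_zero_or_pos (α 1) with h0 | h0
      · simp [h0]
      · refine if_congr ?_ ?_ rfl
        · simp only [Finsupp.tsub_apply, Finsupp.single_apply]
          norm_num
          omega
        · simp
    rw [key, degreePart_monomial]
    split_ifs with hj
    · have hj' : (j + 1 : ℚ) = α 0 + α 1 := by exact_mod_cast hj.symm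
      rw [hj', Polynomial.derivative_C_mul_X_pow]
      rcases Nat.eq_zero_or_pos (α 0) with h0 | h0
      · simp [h0, mul_comm]
      · obtain ⟨n, hn⟩ := Nat.exists_eq_add_of_lt h0
        rw [hn]
        simp only [map_mul, map_add, zero_add, add_tsub_cancel_right, pow_succ]
        ring
    · simp

theorem degreePart_eq_zero_of_neg {j : ℤ} (hj : j < 0) (h : MvPolynomial (Fin 2) ℚ) :
    degreePart j h = 0 := by
  induction h using MvPolynomial.induction_on' with
  | add p q hp hq => rw [map_add, hp, hq, add_zero]
  | monomial α r => rw [degreePart_monomial, if_neg (by omega)]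

theorem degreePart_zero (h : MvPolynomial (Fin 2) ℚ) :
    degreePart 0 h = Polynomial.C (MvPolynomial.constantCoeff h) := by
  induction h using MvPolynomial.induction_on' with
  | add p q hp hq => rw [map_add, hp, hq, map_add, map_add]
  | monomial α r =>
    classical
    rw [degreePart_monomial, MvPolynomial.constantCoeff_monomial]
    have hα : α = 0 ↔ ((α 0 + α 1 : ℕ) : ℤ) = 0 := by
      constructor
      · rintro rfl
        rfl
      · intro h
        ext i
        fin_cases i
        · simp only [Fin.zero_eta, Finsupp.coe_zero, Pi.zero_apply]
          omega
        · simp only [Fin.mk_one, Finsupp.coe_zero, Pi.zero_apply]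
          omega
    by_cases h : α = 0
    · rw [if_pos (hα.1 h), if_pos h, h]
      simp
    · rw [if_neg (mt hα.2 h), if_neg h, map_zero]

/-- The restriction of `fourLines` to the line `X 1 = 1`. -/
noncomputable def threePoints : Polynomial ℚ :=
  Polynomial.X * (Polynomial.X + 1) * (Polynomial.X + 2)

theorem degreePart_fourLines_mul (j : ℤ) (h : MvPolynomial (Fin 2) ℚ) :
    degreePart j (fourLines * h) = threePoints * degreePart (j - 4) h := by
  have hf : fourLines * h =
      MvPolynomial.X 0 * (MvPolynomial.X 0 * (MvPolynomial.X 0 * (MvPolynomial.X 1 * h))) +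
      MvPolynomial.C 3 *
        (MvPolynomial.X 0 * (MvPolynomial.X 0 * (MvPolynomial.X 1 * (MvPolynomial.X 1 * h)))) +
      MvPolynomial.C 2 *
        (MvPolynomial.X 0 * (MvPolynomial.X 1 * (MvPolynomial.X 1 * (MvPolynomial.X 1 * h)))) := by
    rw [fourLines, map_ofNat, map_ofNat]
    ring
  rw [hf, map_add, map_add, degreePart_C_mul, degreePart_C_mul]
  simp only [degreePart_X_zero_mul, degreePart_X_one_mul]
  rw [show j - 1 - 1 - 1 - 1 = j - 4 by ring, threePoints, map_ofNat, map_ofNat]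
  ring

theorem degreePart_fourLines_pow_mul (j : ℤ) (n : ℕ) (h : MvPolynomial (Fin 2) ℚ) :
    degreePart j (fourLines ^ n * h) = threePoints ^ n * degreePart (j - 4 * n) h := by
  induction n generalizing j with
  | zero => simp
  | succ n ih =>
    rw [pow_succ', mul_assoc, degreePart_fourLines_mul, ih, pow_succ', mul_assoc,
      show j - 4 - 4 * (n : ℤ) = j - 4 * ((n + 1 : ℕ) : ℤ) by push_cast; ring]

/-- Evaluation at `c` of the coefficients of a polynomial over `ℚ[X]`. -/
noncomputable def evalParam (c : ℚ) : Polynomial (Polynomial ℚ) →+* Polynomial ℚ :=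
  Polynomial.mapRingHom (Polynomial.evalRingHom c)

theorem evalParam_C (c : ℚ) (p : Polynomial ℚ) :
    evalParam c (Polynomial.C p) = Polynomial.C (Polynomial.eval c p) := by
  simp [evalParam]

theorem evalParam_map_C (c : ℚ) (p : Polynomial ℚ) :
    evalParam c (p.map Polynomial.C) = p := by
  have h : (Polynomial.evalRingHom c).comp Polynomial.C = RingHom.id ℚ :=
    RingHom.ext fun _ => Polynomial.eval_C
  rw [evalParam, Polynomial.coe_mapRingHom, Polynomial.map_map, h, Polynomial.map_id]

theorem evalParam_X (c : ℚ) : evalParam c Polynomial.X = Polynomial.X := by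
  simp [evalParam]

theorem evalParam_derivative (c : ℚ) (a : Polynomial (Polynomial ℚ)) :
    evalParam c (Polynomial.derivative a) = Polynomial.derivative (evalParam c a) := by
  simp [evalParam, Polynomial.derivative_map]

theorem eq_of_evalParam_natCast {a b : Polynomial (Polynomial ℚ)} (N : ℕ)
    (h : ∀ m : ℕ, N ≤ m → evalParam m a = evalParam m b) : a = b := by
  ext1 i
  refine Polynomial.eq_of_infinite_eval_eq _ _ (Set.Infinite.mono ?_
    ((Set.Ici_infinite N).image (Nat.cast_injective (R := ℚ)).injOn))
  rintro _ ⟨m, hm, rfl⟩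
  simpa [evalParam, Polynomial.coeff_map] using congrArg (fun p => p.coeff i) (h m hm)

theorem C_X_add_one_dvd {a : Polynomial (Polynomial ℚ)} (h : evalParam (-1) a = 0) :
    Polynomial.C (Polynomial.X + 1) ∣ a := by
  rw [Polynomial.C_dvd_iff_dvd_coeff]
  intro i
  have hi : Polynomial.eval (-1) (a.coeff i) = 0 := by
    simpa [evalParam, Polynomial.coeff_map] using congrArg (fun p => p.coeff i) h
  simpa using Polynomial.dvd_iff_isRoot.2 hi

/-- `a * threePoints ^ (s - N)`, with `s` the parameter of `a`, interpolates the degree `4 * m + j`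
component of `U m`, and its value at `s = -1` is the degree `j - 4` component of `P`. -/
def Interpolates (U : ℕ → MvPolynomial (Fin 2) ℚ) (P : MvPolynomial (Fin 2) ℚ) (j : ℤ) (N : ℕ)
    (a : Polynomial (Polynomial ℚ)) : Prop :=
  evalParam (-1) a = threePoints ^ (N + 1) * degreePart (j - 4) P ∧
    ∀ m : ℕ, N ≤ m →
      degreePart (4 * m + j) (U m) = evalParam m a * threePoints ^ (m - N)

theorem Interpolates.raise {U : ℕ → MvPolynomial (Fin 2) ℚ} {P : MvPolynomial (Fin 2) ℚ} {j : ℤ}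
    {N : ℕ} {a : Polynomial (Polynomial ℚ)} (h : Interpolates U P j N a) {M : ℕ} (hM : N ≤ M) :
    ∃ a', Interpolates U P j M a' := by
  refine ⟨a * (threePoints.map Polynomial.C) ^ (M - N), ?_, fun m hm => ?_⟩
  · rw [map_mul, map_pow, evalParam_map_C, h.1,
      show threePoints ^ (M + 1) = threePoints ^ (N + 1) * threePoints ^ (M - N) by
        rw [← pow_add]; congr 1; omega]
    ring
  · rw [h.2 m (hM.trans hm), map_mul, map_pow, evalParam_map_C, mul_assoc, ← pow_add,
      show M - N + (m - M) = m - N by omega]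

theorem Interpolates.pderiv_zero {U : ℕ → MvPolynomial (Fin 2) ℚ} {P : MvPolynomial (Fin 2) ℚ}
    {j : ℤ} {N : ℕ} {a : Polynomial (Polynomial ℚ)} (h : Interpolates U P (j + 1) N a) :
    ∃ a', Interpolates (fun m => MvPolynomial.pderiv 0 (U m)) (MvPolynomial.pderiv 0 P) j
      (N + 1) a' := by
  refine ⟨Polynomial.derivative a * threePoints.map Polynomial.C +
    Polynomial.C (Polynomial.X - Polynomial.C (N : ℚ)) *
      (Polynomial.derivative threePoints).map Polynomial.C * a, ?_, fun m hm => ?_⟩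
  · simp only [map_add, map_mul, evalParam_derivative, evalParam_map_C, evalParam_C, h.1,
      degreePart_pderiv_zero, Polynomial.derivative_mul, Polynomial.derivative_pow,
      Polynomial.eval_sub, Polynomial.eval_X, Polynomial.eval_C]
    rw [show j + 1 - 4 = j - 4 + 1 by ring, Nat.add_sub_cancel]
    simp only [map_sub, map_neg, map_one, map_natCast, Nat.cast_add, Nat.cast_one, map_add]
    ring
  · obtain ⟨n, rfl⟩ := Nat.exists_eq_add_of_le hm
    simp only [map_add, map_mul, evalParam_derivative, evalParam_map_C, evalParam_C]
    rw [degreePart_pderiv_zero, add_assoc (4 * _ : ℤ), h.2 _ (by omega),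
      show N + 1 + n - N = n + 1 by omega, show N + 1 + n - (N + 1) = n by omega]
    simp only [Polynomial.derivative_mul, Polynomial.derivative_pow, Nat.add_sub_cancel,
      Polynomial.eval_sub, Polynomial.eval_X, Polynomial.eval_natCast, Nat.cast_add, Nat.cast_one,
      map_add, map_sub, map_one, map_natCast]
    ring

theorem Interpolates.pderiv_one {U : ℕ → MvPolynomial (Fin 2) ℚ} {P : MvPolynomial (Fin 2) ℚ}
    {j : ℤ} {N : ℕ} {a : Polynomial (Polynomial ℚ)} (h : Interpolates U P (j + 1) N a) :
    ∃ a', Interpolates (fun m => MvPolynomial.pderiv 1 (U m)) (MvPolynomial.pderiv 1 P) j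
      (N + 1) a' := by
  obtain ⟨a', h'⟩ := h.pderiv_zero
  refine ⟨Polynomial.C (4 * Polynomial.X + Polynomial.C (j + 1 : ℚ)) * a *
    threePoints.map Polynomial.C - Polynomial.X * a', ?_, fun m hm => ?_⟩
  · have h1 := h'.1
    rw [degreePart_pderiv_zero] at h1
    rw [degreePart_pderiv_one, mul_sub, mul_left_comm _ Polynomial.X, ← h1]
    simp only [map_sub, map_mul, evalParam_map_C, evalParam_C, evalParam_X, h.1]
    rw [show j + 1 - 4 = j - 4 + 1 by ring]
    simp only [Polynomial.eval_add, Polynomial.eval_mul, Polynomial.eval_X, Polynomial.eval_C,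
      Polynomial.eval_ofNat, Polynomial.eval_one, Int.cast_sub,
      Int.cast_ofNat, map_add, map_mul, map_sub, map_neg,
      map_one, map_ofNat]
    ring
  · have h2 := h'.2 m hm
    beta_reduce at h2
    rw [degreePart_pderiv_zero] at h2
    rw [degreePart_pderiv_one, h2, add_assoc (4 * _ : ℤ), h.2 m (by omega)]
    simp only [map_sub, map_mul, evalParam_map_C, evalParam_C, evalParam_X]
    rw [show m - N = m - (N + 1) + 1 by omega]
    simp only [Polynomial.eval_add, Polynomial.eval_mul, Polynomial.eval_X, Polynomial.eval_C,
      Polynomial.eval_ofNat, Polynomial.eval_one, Int.cast_add,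
      Int.cast_mul, Int.cast_ofNat, Int.cast_natCast, map_add,
      map_mul, map_one, map_ofNat]
    ring

theorem DSeq.exists_interpolates {U : ℕ → MvPolynomial (Fin 2) ℚ} (hU : DSeq fourLines U) :
    ∃ P, ∀ j, ∃ N a, Interpolates U P j N a := by
  induction hU with
  | base =>
    refine ⟨1, fun j => ⟨0, (threePoints * degreePart (j - 4) 1).map Polynomial.C, ?_,
      fun m _ => ?_⟩⟩
    · rw [evalParam_map_C, zero_add, pow_one]
    · beta_reduce
      rw [evalParam_map_C, ← mul_one (fourLines ^ (m + 1)), degreePart_fourLines_pow_mul, pow_succ,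
        show 4 * (m : ℤ) + j - 4 * ((m + 1 : ℕ) : ℤ) = j - 4 by push_cast; ring, Nat.sub_zero]
      ring
  | add _ _ hU hV =>
    obtain ⟨P, hP⟩ := hU
    obtain ⟨Q, hQ⟩ := hV
    refine ⟨P + Q, fun j => ?_⟩
    obtain ⟨N, a, ha⟩ := hP j
    obtain ⟨M, b, hb⟩ := hQ j
    obtain ⟨a', ha'⟩ := ha.raise (le_max_left N M)
    obtain ⟨b', hb'⟩ := hb.raise (le_max_right N M)
    refine ⟨max N M, a' + b', ?_, fun m hm => ?_⟩
    · rw [map_add, ha'.1, hb'.1, map_add, mul_add]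
    · rw [map_add, map_add, ha'.2 m hm, hb'.2 m hm, add_mul]
  | const_mul r _ hU =>
    obtain ⟨P, hP⟩ := hU
    refine ⟨MvPolynomial.C r * P, fun j => ?_⟩
    obtain ⟨N, a, ha⟩ := hP j
    refine ⟨N, Polynomial.C (Polynomial.C r) * a, ?_, fun m hm => ?_⟩
    · rw [map_mul, ha.1, evalParam_C, degreePart_C_mul, Polynomial.eval_C]
      ring
    · rw [degreePart_C_mul, ha.2 m hm, map_mul, evalParam_C, Polynomial.eval_C, mul_assoc]
  | X_mul i _ hU =>
    obtain ⟨P, hP⟩ := hU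
    refine ⟨MvPolynomial.X i * P, fun j => ?_⟩
    obtain ⟨N, a, ha⟩ := hP (j - 1)
    obtain rfl | rfl : i = 0 ∨ i = 1 := by omega
    · refine ⟨N, Polynomial.X * a, ?_, fun m hm => ?_⟩
      · rw [map_mul, ha.1, evalParam_X, degreePart_X_zero_mul, sub_right_comm]
        ring
      · rw [degreePart_X_zero_mul, add_sub_assoc, ha.2 m hm, map_mul, evalParam_X, mul_assoc]
    · refine ⟨N, a, ?_, fun m hm => ?_⟩
      · rw [ha.1, degreePart_X_one_mul, sub_right_comm]
      · rw [degreePart_X_one_mul, add_sub_assoc, ha.2 m hm]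
  | index_mul _ hU =>
    obtain ⟨P, hP⟩ := hU
    refine ⟨-P, fun j => ?_⟩
    obtain ⟨N, a, ha⟩ := hP j
    refine ⟨N, Polynomial.C Polynomial.X * a, ?_, fun m hm => ?_⟩
    · rw [map_mul, ha.1, evalParam_C, map_neg, Polynomial.eval_X, map_neg, map_one]
      ring
    · beta_reduce
      rw [← map_natCast (MvPolynomial.C : ℚ →+* MvPolynomial (Fin 2) ℚ), degreePart_C_mul,
        ha.2 m hm, map_mul, evalParam_C, Polynomial.eval_X, mul_assoc]
  | pderiv i _ hU =>
    obtain ⟨P, hP⟩ := hU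
    refine ⟨MvPolynomial.pderiv i P, fun j => ?_⟩
    obtain ⟨N, a, ha⟩ := hP (j + 1)
    obtain rfl | rfl : i = 0 ∨ i = 1 := by omega
    · exact ⟨N + 1, ha.pderiv_zero⟩
    · exact ⟨N + 1, ha.pderiv_one⟩

theorem threePoints_ne_zero : threePoints ≠ 0 := by
  intro h
  have h1 := congrArg (Polynomial.eval 1) h
  norm_num [threePoints] at h1

theorem derivative_threePoints : Polynomial.derivative threePoints =
    3 * Polynomial.X ^ 2 + 6 * Polynomial.X + 2 := by
  simp only [threePoints, Polynomial.derivative_mul, Polynomial.derivative_add,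
    Polynomial.derivative_X, Polynomial.derivative_one, Polynomial.derivative_ofNat]
  ring

theorem isCoprime_threePoints_derivative :
    IsCoprime threePoints (Polynomial.derivative threePoints) := by
  refine ⟨Polynomial.C (-9 / 2) * (Polynomial.X + 1),
    Polynomial.C (3 / 2) * (Polynomial.X + 1) ^ 2 - 1, ?_⟩
  have h : (Polynomial.C (-9 / 2) : Polynomial ℚ) = Polynomial.C (3 / 2) * Polynomial.C (-3) := by
    rw [← map_mul]
    norm_num
  have h' : (2 : Polynomial ℚ) * Polynomial.C (3 / 2) = 3 := by
    rw [← map_ofNat Polynomial.C, ← map_mul, ← map_ofNat Polynomial.C]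
    norm_num
  rw [derivative_threePoints, threePoints, h, map_neg, map_ofNat]
  linear_combination (Polynomial.X + 1) ^ 2 * h'

/-- A twisted-exact form with poles along `threePoints` whose value has no poles is the
differential of a form without poles. -/
theorem exists_eq_of_pole_order {σ β : ℚ} {c : Polynomial ℚ} (hσ : ∀ n : ℕ, σ ≠ n) (N : ℕ)
    {a : Polynomial ℚ}
    (h : Polynomial.C β * threePoints ^ (N + 1) = c * threePoints ^ (N + 2) +
      (Polynomial.derivative a * threePoints +
        Polynomial.C (σ - N) * Polynomial.derivative threePoints * a)) :
    ∃ v, Polynomial.C β = c * threePoints + (Polynomial.derivative v * threePoints +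
      Polynomial.C (σ + 1) * Polynomial.derivative threePoints * v) := by
  have hdvd : ∀ (N : ℕ) (a : Polynomial ℚ), Polynomial.C β * threePoints ^ (N + 1) =
      c * threePoints ^ (N + 2) + (Polynomial.derivative a * threePoints +
        Polynomial.C (σ - N) * Polynomial.derivative threePoints * a) → threePoints ∣ a := by
    intro N a h
    have hunit : IsUnit (Polynomial.C (σ - N)) :=
      Polynomial.isUnit_C.2 (sub_ne_zero.2 (hσ N)).isUnit
    refine ((isCoprime_mul_unit_left_right hunit _ _).2
      isCoprime_threePoints_derivative).dvd_of_dvd_mul_left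
      ⟨Polynomial.C β * threePoints ^ N - c * threePoints ^ (N + 1) - Polynomial.derivative a, ?_⟩
    linear_combination -h
  induction N generalizing a with
  | zero =>
    obtain ⟨a, rfl⟩ := hdvd _ a h
    refine ⟨a, mul_right_cancel₀ threePoints_ne_zero ?_⟩
    rw [map_add, map_one]
    rw [Polynomial.derivative_mul, Nat.cast_zero, sub_zero] at h
    linear_combination h
  | succ N ih =>
    obtain ⟨a, rfl⟩ := hdvd _ a h
    refine ih (a := a) (mul_right_cancel₀ threePoints_ne_zero ?_)
    rw [Polynomial.derivative_mul, Nat.cast_succ, ← sub_sub, map_sub _ _ (1 : ℚ), map_one] at h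
    linear_combination h

theorem coeff_twisted_differential (τ : ℚ) (v : Polynomial ℚ) :
    (Polynomial.derivative v * threePoints +
      Polynomial.C τ * Polynomial.derivative threePoints * v).coeff (v.natDegree + 2) =
      (v.natDegree + 3 * τ) * v.leadingCoeff := by
  have h1 : v.coeff (v.natDegree + 1) = 0 := Polynomial.coeff_eq_zero_of_natDegree_lt (by omega)
  have h2 : v.coeff (v.natDegree + 2) = 0 := Polynomial.coeff_eq_zero_of_natDegree_lt (by omega)
  have h : Polynomial.derivative v * threePoints +
      Polynomial.C τ * Polynomial.derivative threePoints * v =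
      Polynomial.derivative v * Polynomial.X * Polynomial.X ^ 2 +
      Polynomial.C 3 * (Polynomial.derivative v * Polynomial.X ^ 2) +
      Polynomial.C 2 * (Polynomial.derivative v * Polynomial.X) +
      (Polynomial.C (3 * τ) * (v * Polynomial.X ^ 2) + Polynomial.C (6 * τ) * (v * Polynomial.X) +
        Polynomial.C (2 * τ) * v) := by
    rw [derivative_threePoints, threePoints]
    simp only [map_mul, map_ofNat]
    ring
  have h0 : (Polynomial.derivative v * Polynomial.X).coeff v.natDegree =
      v.natDegree * v.leadingCoeff := by
    cases hn : v.natDegree with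
    | zero => simp
    | succ n =>
      rw [Polynomial.coeff_mul_X, Polynomial.coeff_derivative, Polynomial.leadingCoeff, hn]
      push_cast
      ring
  rw [h]
  simp only [Polynomial.coeff_add, Polynomial.coeff_C_mul, Polynomial.coeff_mul_X_pow, h0, h2]
  rw [Polynomial.coeff_mul_X (n := v.natDegree + 1), Polynomial.coeff_mul_X (n := v.natDegree + 1),
    Polynomial.coeff_derivative, Polynomial.coeff_derivative, h1, h2, Polynomial.leadingCoeff]
  ring

theorem eq_zero_of_le_natDegree_of_eq_differential {β τ γ : ℚ} {v : Polynomial ℚ} {d : ℕ}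
    (hτ : ∀ n : ℕ, (n + 3 * τ : ℚ) ≠ 0) (hγ : 2 ≤ d ∨ γ = 0)
    (h : Polynomial.C β = Polynomial.C γ * threePoints + (Polynomial.derivative v * threePoints +
      Polynomial.C τ * Polynomial.derivative threePoints * v)) (hd : d ≤ v.natDegree) : v = 0 := by
  have hF : (Polynomial.C γ * threePoints).coeff (v.natDegree + 2) = 0 := by
    rcases hγ with hγ | rfl
    · refine Polynomial.coeff_eq_zero_of_natDegree_lt (lt_of_le_of_lt (b := 3) ?_ (by omega))
      rw [threePoints]
      compute_degree
    · simp
  have hc := congrArg (fun p => p.coeff (v.natDegree + 2)) h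
  simp only [Polynomial.coeff_add (p := Polynomial.C γ * threePoints), hF,
    coeff_twisted_differential, Polynomial.coeff_C_succ, zero_add] at hc
  exact Polynomial.leadingCoeff_eq_zero.1 ((mul_eq_zero.1 hc.symm).resolve_left (hτ _))

theorem eq_zero_of_eq_differential {β τ : ℚ} {v : Polynomial ℚ}
    (hτ : ∀ n : ℕ, (n + 3 * τ : ℚ) ≠ 0)
    (h : Polynomial.C β = Polynomial.derivative v * threePoints +
      Polynomial.C τ * Polynomial.derivative threePoints * v) : β = 0 := by
  have hv : v = 0 := eq_zero_of_le_natDegree_of_eq_differential (β := β) (γ := 0) hτ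
    (Or.inr rfl)
    (by rw [map_zero, zero_mul, zero_add]; exact h) (Nat.zero_le _)
  simpa [hv] using h

theorem eq_zero_of_eq_add_differential {β γ : ℚ} {v : Polynomial ℚ}
    (h : Polynomial.C β = Polynomial.C γ * threePoints + (Polynomial.derivative v * threePoints +
      Polynomial.C (-1 / 2) * Polynomial.derivative threePoints * v)) : β = 0 := by
  have hv : ∃ p q, v = Polynomial.C p * Polynomial.X + Polynomial.C q := by
    refine Polynomial.exists_eq_X_add_C_of_natDegree_le_one ?_
    by_contra hn
    have hv := eq_zero_of_le_natDegree_of_eq_differential (d := 2) (fun n hn => ?_) (Or.inl le_rfl) h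
      (by omega)
    · simp [hv] at hn
    · have h2 : ((2 * n : ℕ) : ℚ) = (3 : ℕ) := by
        push_cast
        linarith
      have := Nat.cast_injective h2
      omega
  obtain ⟨p, q, rfl⟩ := hv
  rw [derivative_threePoints, threePoints] at h
  have h0 := congrArg (Polynomial.eval 0) h
  have h1 := congrArg (Polynomial.eval (-1)) h
  have h2 := congrArg (Polynomial.eval (-2)) h
  simp only [Polynomial.eval_add, Polynomial.eval_mul, Polynomial.eval_C, Polynomial.eval_X,
    Polynomial.eval_one, Polynomial.eval_ofNat, Polynomial.eval_pow] at h0 h1 h2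
  linarith

theorem exists_degreePart_eval (q : Polynomial (MvPolynomial (Fin 2) ℚ)) {j : ℤ} (hj : j ≤ 0) :
    ∃ c : Polynomial ℚ, (j < 0 → c = 0) ∧ ∀ m : ℕ,
      degreePart j (Polynomial.eval (m : MvPolynomial (Fin 2) ℚ) q) =
        Polynomial.C (Polynomial.eval (m : ℚ) c) := by
  rcases hj.lt_or_eq with hj | rfl
  · exact ⟨0, fun _ => rfl, fun m => by simp [degreePart_eq_zero_of_neg hj]⟩
  · refine ⟨q.map MvPolynomial.constantCoeff, fun h => absurd h (lt_irrefl 0), fun m => ?_⟩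
    have h := Polynomial.eval_map_apply (p := q) (MvPolynomial.constantCoeff (R := ℚ))
      (m : MvPolynomial (Fin 2) ℚ)
    rw [map_natCast] at h
    rw [degreePart_zero, h]

/-- The functional equation restricted to the line `X 1 = 1`, after multiplication by `X 1 ^ k`
and integration by parts. -/
theorem DSeq.exists_differential_identity {b : Polynomial ℚ}
    (hb : DSeq fourLines fun m => MvPolynomial.C (Polynomial.eval (m : ℚ) b) * fourLines ^ m)
    {k : ℕ} (hk : k ≤ 4) :
    ∃ (c : Polynomial ℚ) (N : ℕ) (a w : Polynomial (Polynomial ℚ)),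
      (k < 4 → c = 0) ∧ (k < 3 → evalParam (-1) a = 0 ∧ evalParam (-1) w = 0) ∧
      Polynomial.C b * (threePoints.map Polynomial.C) ^ (N + 1) =
        Polynomial.C c * (threePoints.map Polynomial.C) ^ (N + 2) +
        (Polynomial.derivative a * threePoints.map Polynomial.C +
          Polynomial.C (Polynomial.X - Polynomial.C (N : ℚ)) *
            (Polynomial.derivative threePoints).map Polynomial.C * a) +
        Polynomial.C (4 * Polynomial.X + Polynomial.C (k + 2 : ℚ)) *
          threePoints.map Polynomial.C * w := by
  obtain ⟨q, V, W, hV, hW, h⟩ := hb.exists_poly_mul_eq (Polynomial.C (MvPolynomial.X 1 ^ k))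
  obtain ⟨P, hP⟩ := hV.exists_interpolates
  obtain ⟨Q, hQ⟩ := hW.exists_interpolates
  obtain ⟨N₁, v₁, hv₁⟩ := hP (k + 1)
  obtain ⟨N₂, w₂, hw₂⟩ := hQ (k + 1)
  obtain ⟨v, hv⟩ := hv₁.raise (le_max_left N₁ N₂)
  obtain ⟨w, hw⟩ := hw₂.raise (le_max_right N₁ N₂)
  obtain ⟨c, hc0, hc⟩ := exists_degreePart_eval q (j := k - 4) (by omega)
  generalize max N₁ N₂ = N at hv hw
  refine ⟨c, N, v - Polynomial.X * w, w, fun hk => hc0 (by omega), fun hk => ?_, ?_⟩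
  · have hj : ((k : ℤ) + 1 - 4) < 0 := by omega
    have hv0 := hv.1
    have hw0 := hw.1
    rw [degreePart_eq_zero_of_neg hj, mul_zero] at hv0 hw0
    simp [hv0, hw0]
  refine eq_of_evalParam_natCast (N + 1) fun m hm => ?_
  obtain ⟨n, rfl⟩ := Nat.exists_eq_add_of_le hm
  have hX : ∀ i : ℕ, degreePart i (MvPolynomial.X 1 ^ i) = 1 := by
    intro i
    rw [MvPolynomial.X_pow_eq_monomial, degreePart_monomial]
    simp
  generalize hM : N + 1 + n = m at *
  have hL := congrArg (degreePart (4 * m + k)) (h m)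
  have hv' := hv.2 m (by omega)
  have hw' := hw.2 m (by omega)
  rw [Polynomial.eval_C, mul_left_comm, mul_comm (MvPolynomial.X 1 ^ k), degreePart_C_mul,
    degreePart_fourLines_pow_mul, add_sub_cancel_left, hX, map_add, map_add,
    mul_comm _ (fourLines ^ (m + 1)), degreePart_fourLines_pow_mul,
    show 4 * (m : ℤ) + k - 4 * ((m + 1 : ℕ) : ℤ) = k - 4 by push_cast; ring, hc,
    degreePart_pderiv_zero, degreePart_pderiv_one, add_assoc (4 * (m : ℤ)), hv', hw',
    show m - N = n + 1 by omega] at hL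
  refine mul_right_cancel₀ (pow_ne_zero n threePoints_ne_zero) ?_
  have hmN : (m : Polynomial ℚ) = N + 1 + n := by
    rw [← hM]
    push_cast
    ring
  simp only [map_add, map_sub, map_mul, map_pow, evalParam_C, evalParam_map_C, evalParam_X,
    evalParam_derivative, Polynomial.derivative_mul, Polynomial.derivative_X, Polynomial.eval_X,
    map_natCast, map_ofNat, Polynomial.derivative_pow, Nat.add_sub_cancel, Int.cast_add,
    Int.cast_mul, Int.cast_natCast, Int.cast_ofNat, Nat.cast_add, Nat.cast_one, map_one] at hL ⊢
  rw [show threePoints ^ m = threePoints ^ (N + 1) * threePoints ^ n by rw [← pow_add, hM],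
    show threePoints ^ (m + 1) = threePoints ^ (N + 1) * threePoints ^ n * threePoints by
      rw [← pow_add, hM, pow_succ]] at hL
  rw [hmN] at hL ⊢
  linear_combination hL

theorem DSeq.eval_eq_zero {b : Polynomial ℚ}
    (hb : DSeq fourLines fun m => MvPolynomial.C (Polynomial.eval (m : ℚ) b) * fourLines ^ m)
    {k : ℕ} (hk : k ≤ 4) (hk2 : k ≠ 2) : Polynomial.eval (-(k + 2) / 4 : ℚ) b = 0 := by
  obtain ⟨c, N, a, w, hc, -, h⟩ := hb.exists_differential_identity hk
  have h' := congrArg (evalParam (-(k + 2) / 4)) h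
  simp only [map_add _ _ (Polynomial.C _ * _ * w), map_add _ (Polynomial.C c * _), map_mul,
    map_pow, evalParam_C, evalParam_map_C] at h'
  rw [map_add, map_mul, map_mul, map_mul, evalParam_C, evalParam_map_C, evalParam_map_C,
    evalParam_derivative] at h'
  have h0 : Polynomial.eval (-(k + 2) / 4 : ℚ)
      (4 * Polynomial.X + Polynomial.C (k + 2 : ℚ)) = 0 := by
    simp only [Polynomial.eval_add, Polynomial.eval_mul, Polynomial.eval_X, Polynomial.eval_C,
      Polynomial.eval_ofNat]
    ring
  rw [h0, map_zero, zero_mul, zero_mul, add_zero, Polynomial.eval_sub, Polynomial.eval_X,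
    Polynomial.eval_C] at h'
  obtain ⟨v, hv⟩ := exists_eq_of_pole_order (fun n hn => by
    have : (0 : ℚ) ≤ n := n.cast_nonneg
    have : (0 : ℚ) ≤ k := k.cast_nonneg
    linarith) N h'
  rcases hk.lt_or_eq with hk | rfl
  · rw [hc hk, Polynomial.eval_zero, map_zero, zero_mul, zero_add] at hv
    refine eq_zero_of_eq_differential (fun n hn => ?_) hv
    have h4 : ((4 * n + 6 : ℕ) : ℚ) = (3 * k : ℕ) := by
      push_cast
      linarith
    have := Nat.cast_injective h4
    omega
  · refine eq_zero_of_eq_add_differential (γ := Polynomial.eval (-((4 : ℕ) + 2) / 4 : ℚ) c)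
      (v := v) ?_
    convert hv using 4
    norm_num

theorem DSeq.X_add_one_sq_dvd {b : Polynomial ℚ}
    (hb : DSeq fourLines fun m => MvPolynomial.C (Polynomial.eval (m : ℚ) b) * fourLines ^ m) :
    (Polynomial.X + 1) ^ 2 ∣ b := by
  obtain ⟨c, N, a, w, hc, haw, h⟩ := hb.exists_differential_identity (k := 2) (by norm_num)
  obtain ⟨ha, hw⟩ := haw (by norm_num)
  have hlin : ∀ p : Polynomial ℚ, Polynomial.eval (-1) p = 0 → Polynomial.X + 1 ∣ p :=
    fun p hp => by simpa using Polynomial.dvd_iff_isRoot.2 hp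
  have hb0 : Polynomial.eval (-1) b = 0 := by
    have h' := congrArg (evalParam (-1)) h
    simp only [hc (by norm_num), map_add, map_mul, map_pow, evalParam_C, evalParam_map_C,
      evalParam_derivative, ha, hw, map_zero, zero_mul, mul_zero,
      add_zero] at h'
    exact Polynomial.C_eq_zero.1
      ((mul_eq_zero.1 h').resolve_right (pow_ne_zero _ threePoints_ne_zero))
  obtain ⟨b, rfl⟩ := hlin b hb0
  obtain ⟨a, rfl⟩ := C_X_add_one_dvd ha
  rw [pow_two]
  refine mul_dvd_mul_left _ (hlin b ?_)
  have hne : (Polynomial.C (Polynomial.X + 1) : Polynomial (Polynomial ℚ)) ≠ 0 :=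
    Polynomial.C_ne_zero.2 (Polynomial.X_add_C_ne_zero 1)
  have h4 : (Polynomial.C (4 * Polynomial.X + Polynomial.C ((2 : ℕ) + 2 : ℚ)) :
      Polynomial (Polynomial ℚ)) = Polynomial.C (Polynomial.X + 1) * 4 := by
    have h2 : (Polynomial.C ((2 : ℕ) + 2 : ℚ) : Polynomial ℚ) = 4 := by
      rw [← map_ofNat Polynomial.C 4]
      norm_num
    rw [h2]
    simp only [map_add, map_mul, map_ofNat, map_one]
    ring
  have h' : Polynomial.C b * (threePoints.map Polynomial.C) ^ (N + 1) =
      (Polynomial.derivative a * threePoints.map Polynomial.C +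
        Polynomial.C (Polynomial.X - Polynomial.C (N : ℚ)) *
          (Polynomial.derivative threePoints).map Polynomial.C * a) +
      4 * threePoints.map Polynomial.C * w := by
    refine mul_left_cancel₀ hne ?_
    rw [hc (by norm_num), h4, Polynomial.derivative_C_mul, map_mul, map_zero] at h
    linear_combination h
  have h'' := congrArg (evalParam (-1)) h'
  simp only [map_add, map_mul, map_pow, evalParam_C, evalParam_map_C, evalParam_derivative, hw,
    mul_zero, add_zero, Polynomial.eval_sub, Polynomial.eval_X, Polynomial.eval_C] at h''
  obtain ⟨v, hv⟩ := exists_eq_of_pole_order (σ := -1) (c := 0) (fun n hn => by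
    have : (0 : ℚ) ≤ n := n.cast_nonneg
    linarith) N (by rw [zero_mul, zero_add]; exact h'')
  have hv0 := congrArg (Polynomial.eval 0) hv
  simpa [threePoints] using hv0

theorem DSeq.dvd {b : Polynomial ℚ}
    (hb : DSeq fourLines fun m => MvPolynomial.C (Polynomial.eval (m : ℚ) b) * fourLines ^ m) :
    (Polynomial.X + Polynomial.C (1 / 2 : ℚ)) * (Polynomial.X + Polynomial.C (3 / 4 : ℚ)) *
      (Polynomial.X + Polynomial.C (1 : ℚ)) ^ 2 * (Polynomial.X + Polynomial.C (5 / 4 : ℚ)) *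
      (Polynomial.X + Polynomial.C (3 / 2 : ℚ)) ∣ b := by
  have hroot : ∀ {k : ℕ} (r : ℚ), k ≤ 4 → k ≠ 2 → r = (k + 2) / 4 →
      Polynomial.X + Polynomial.C r ∣ b := by
    rintro k r hk hk2 rfl
    rw [← sub_neg_eq_add, ← map_neg, ← neg_div]
    exact Polynomial.dvd_iff_isRoot.2 (hb.eval_eq_zero hk hk2)
  have hcop : ∀ {r t : ℚ}, r ≠ t →
      IsCoprime (Polynomial.X + Polynomial.C r) (Polynomial.X + Polynomial.C t) := by
    intro r t hrt
    simpa using Polynomial.isCoprime_X_sub_C_of_isUnit_sub (a := -r) (b := -t)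
      (sub_ne_zero.2 (neg_injective.ne hrt)).isUnit
  refine IsCoprime.mul_dvd ?_ (IsCoprime.mul_dvd ?_ (IsCoprime.mul_dvd ?_ (IsCoprime.mul_dvd ?_
    (hroot (k := 0) _ (by norm_num) (by norm_num) (by norm_num))
    (hroot (k := 1) _ (by norm_num) (by norm_num) (by norm_num)))
    (by simpa using hb.X_add_one_sq_dvd))
    (hroot (k := 3) _ (by norm_num) (by norm_num) (by norm_num)))
    (hroot (k := 4) _ (by norm_num) (by norm_num) (by norm_num))
  · exact (((hcop (by norm_num)).mul_left (hcop (by norm_num))).mul_left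
      (hcop (by norm_num)).pow_left).mul_left (hcop (by norm_num))
  · exact ((hcop (by norm_num)).mul_left (hcop (by norm_num))).mul_left
      (hcop (by norm_num)).pow_left
  · exact (hcop (by norm_num)).pow_right.mul_left (hcop (by norm_num)).pow_right
  · exact hcop (by norm_num)

theorem bernsteinSato_stmt_15 :
    ∀ b : Polynomial ℚ,
      SatisfiesBS (X 0 * X 1 * (X 0 + X 1) * (X 0 + 2 * X 1) : MvPolynomial (Fin 2) ℚ)
          (1) b ↔
        (Polynomial.X + Polynomial.C (1 / 2 : ℚ)) *
            (Polynomial.X + Polynomial.C (3 / 4 : ℚ)) *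
            (Polynomial.X + Polynomial.C (1 : ℚ)) ^ 2 *
            (Polynomial.X + Polynomial.C (5 / 4 : ℚ)) *
            (Polynomial.X + Polynomial.C (3 / 2 : ℚ)) ∣ b := by
  intro b
  exact (satisfiesBS_one_iff fourLines b).trans ⟨DSeq.dvd, dseq_fourLines_of_dvd⟩
end
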